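/- arXiv:1911.04656 — 6 statements merged into one kernel-verified Lean document; each statement's English description precedes it below -/
import Mathlib

section
/- Let X be a length space and let Φ : ℝⁿ → X be an L-Lipschitz map (L ≥ 1, A ≥ 0) which is also an (L,A)-quasi-isometric embedding, with image Q = Φ(ℝⁿ). Then there exist a constant L̄ depending only on L and A (one may take L̄ = 2L + A), a metric space X̄, an L̄-bilipschitz embedding ι : X → X̄, an L-Lipschitz map r : X̄ → X with r ∘ ι = id_X, and an L̄-bilipschitz embedding Φ̄ : ℝⁿ → X̄ whose image Q̄ = Φ̄(ℝⁿ) satisfies d_H(ι(Q), Q̄) ≤ L and d_H(ι(X), X̄) ≤ L, where d_H denotes Hausdorff distance in X̄. -/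
open Metric Set

/-- `f` is an `(L,A)`-quasi-isometric embedding. -/
def IsQIEmb {X Y : Type*} [PseudoMetricSpace X] [PseudoMetricSpace Y]
    (L A : ℝ) (f : X → Y) : Prop :=
  ∀ x x' : X,
    L⁻¹ * dist x x' - A ≤ dist (f x) (f x') ∧ dist (f x) (f x') ≤ L * dist x x' + A

/-- `f` is an `L`-bilipschitz embedding. -/
def IsBilipEmb {X Y : Type*} [PseudoMetricSpace X] [PseudoMetricSpace Y]
    (L : ℝ) (f : X → Y) : Prop :=
  ∀ x x' : X, L⁻¹ * dist x x' ≤ dist (f x) (f x') ∧ dist (f x) (f x') ≤ L * dist x x'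

/-- `X` is a length space: the distance between any two points equals the infimum of the
lengths (total variations) of continuous paths joining them. -/
def IsLengthSpace (X : Type*) [MetricSpace X] : Prop :=
  ∀ x y : X,
    edist x y =
      ⨅ (γ : ℝ → X) (_ : ContinuousOn γ (Set.Icc (0:ℝ) 1)) (_ : γ 0 = x) (_ : γ 1 = y),
        eVariationOn γ (Set.Icc (0:ℝ) 1)

/-- The conclusion of the thickening lemma, relative to a target metric space `Y`:
there are an `Lbar`-bilipschitz embedding `ι : X → Y`, an `L`-Lipschitz retraction
`r : Y → X` with `r ∘ ι = id`, and an `Lbar`-bilipschitz flat `Φbar : ℝⁿ → Y` whose image is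
at Hausdorff distance `≤ L` from `ι(Q)`, with `ι(X)` at Hausdorff distance `≤ L` from `Y`. -/
def Stmt0Concl (n : ℕ) (L Lbar : ℝ) (X : Type) [MetricSpace X]
    (Φ : EuclideanSpace ℝ (Fin n) → X) (Y : Type) [iY : MetricSpace Y] : Prop :=
  ∃ (ι : X → Y) (r : Y → X) (Φbar : EuclideanSpace ℝ (Fin n) → Y),
    IsBilipEmb Lbar ι ∧
    (∀ a b : Y, dist (r a) (r b) ≤ L * dist a b) ∧
    (∀ x : X, r (ι x) = x) ∧
    IsBilipEmb Lbar Φbar ∧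
    EMetric.hausdorffEdist (ι '' Set.range Φ) (Set.range Φbar) ≤ ENNReal.ofReal L ∧
    EMetric.hausdorffEdist (Set.range ι) (Set.univ : Set Y) ≤ ENNReal.ofReal L

section MappingCylinder

variable {X E : Type*} [MetricSpace X] [MetricSpace E]

/-- The distance on the disjoint union of `X` and `E` in which each `p : E` is attached to `Φ p`
by a segment of length `s`. -/
noncomputable def cylinderDist (L s : ℝ) (Φ : E → X) : X ⊕ E → X ⊕ E → ℝ
  | .inl x, .inl y => dist x y
  | .inl x, .inr q => dist x (Φ q) + s
  | .inr p, .inl y => dist (Φ p) y + s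
  | .inr p, .inr q => min (L * dist p q) (dist (Φ p) (Φ q) + 2 * s)

/-- The ends `X` and `E` of the mapping cylinder, of height `s`, of an `L`-Lipschitz map. -/
@[reducible] noncomputable def cylinderMetricSpace {L s : ℝ} (hL : 0 < L) (hs : 0 < s) {Φ : E → X}
    (hΦ : ∀ p q, dist (Φ p) (Φ q) ≤ L * dist p q) : MetricSpace (X ⊕ E) where
  dist := cylinderDist L s Φ
  dist_self := by
    rintro (x | p) <;> simp [cylinderDist, hs.le]
  dist_comm := by
    rintro (x | p) (y | q) <;> simp [cylinderDist, dist_comm]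
  dist_triangle := by
    rintro (x | p) (y | q) (z | r) <;> simp only [cylinderDist]
    · exact dist_triangle x y z
    · linarith [dist_triangle x y (Φ r)]
    · linarith [dist_triangle x (Φ q) z]
    · rcases min_cases (L * dist q r) (dist (Φ q) (Φ r) + 2 * s) with h | h <;>
        linarith [hΦ q r, dist_triangle x (Φ q) (Φ r)]
    · linarith [dist_triangle (Φ p) y z]
    · exact (min_le_right _ _).trans (by linarith [dist_triangle (Φ p) y (Φ r)])
    · rcases min_cases (L * dist p q) (dist (Φ p) (Φ q) + 2 * s) with h | h <;>
        linarith [hΦ p q, dist_triangle (Φ p) (Φ q) z]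
    · have hE := mul_le_mul_of_nonneg_left (dist_triangle p q r) hL.le
      have hX := dist_triangle (Φ p) (Φ q) (Φ r)
      rcases min_cases (L * dist p q) (dist (Φ p) (Φ q) + 2 * s) with h | h <;>
        rcases min_cases (L * dist q r) (dist (Φ q) (Φ r) + 2 * s) with h' | h' <;>
        rcases min_cases (L * dist p r) (dist (Φ p) (Φ r) + 2 * s) with h'' | h'' <;>
        linarith [hΦ p q, hΦ q r]
  eq_of_dist_eq_zero := by
    rintro (x | p) (y | q) h <;> simp only [cylinderDist] at h
    · rw [dist_eq_zero.1 h]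
    · linarith [dist_nonneg (x := x) (y := Φ q)]
    · linarith [dist_nonneg (x := Φ p) (y := y)]
    · have hX := dist_nonneg (x := Φ p) (y := Φ q)
      rcases min_cases (L * dist p q) (dist (Φ p) (Φ q) + 2 * s) with h' | h'
      · have : dist p q = 0 := by
          simpa [hL.ne'] using h'.1.symm.trans h
        rw [dist_eq_zero.1 this]
      · linarith

/-- The map collapsing the mapping cylinder onto its target does not increase distances. -/
lemma dist_collapse_le_cylinderDist {L s : ℝ} (hs : 0 ≤ s) {Φ : E → X}
    (hΦ : ∀ p q, dist (Φ p) (Φ q) ≤ L * dist p q) (a b : X ⊕ E) :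
    dist (Sum.elim id Φ a) (Sum.elim id Φ b) ≤ cylinderDist L s Φ a b := by
  rcases a with x | p <;> rcases b with y | q <;>
    simp only [cylinderDist, Sum.elim_inl, Sum.elim_inr, id]
  · rfl
  · linarith
  · linarith
  · exact le_min (hΦ p q) (by linarith)

end MappingCylinder

lemma isBilipEmb_of_dist_eq {X Y : Type*} [PseudoMetricSpace X] [PseudoMetricSpace Y] {L : ℝ}
    (hL : 1 ≤ L) {f : X → Y} (hf : ∀ x y, dist (f x) (f y) = dist x y) : IsBilipEmb L f := by
  intro x y
  rw [hf]
  exact ⟨mul_le_of_le_one_left dist_nonneg (inv_le_one_of_one_le₀ hL),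
    le_mul_of_one_le_left dist_nonneg hL⟩

lemma inv_mul_le_of_inv_mul_sub_le {L A D d : ℝ} (hL : 0 < L) (hA : 0 ≤ A) (hd : 0 ≤ d)
    (h : L⁻¹ * D - A ≤ d) : (2 * L + A)⁻¹ * D ≤ d + 2 * L := by
  have hD : D ≤ L * (d + A) := by
    rwa [sub_le_iff_le_add, inv_mul_le_iff₀ hL] at h
  rw [inv_mul_le_iff₀ (by linarith)]
  nlinarith [mul_nonneg hL.le hd, mul_nonneg hA hd, mul_nonneg hL.le hA, mul_pos hL hL]

/-- A Lipschitz quasiflat in a length space can be thickened to an actual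
bilipschitz flat in an ambient thickening `X̄` of `X`, with constant `L̄ = 2L + A`. -/
theorem thickening_of_lipschitz_quasiflat (n : ℕ) (L A : ℝ) (hL : 1 ≤ L) (hA : 0 ≤ A) :
    ∃ Lbar : ℝ, Lbar = 2 * L + A ∧
      ∀ (X : Type) [MetricSpace X], IsLengthSpace X →
        ∀ Φ : EuclideanSpace ℝ (Fin n) → X,
          (∀ x y, dist (Φ x) (Φ y) ≤ L * dist x y) →
          IsQIEmb L A Φ →
          ∃ (Y : Type) (iY : MetricSpace Y),
            Stmt0Concl n L Lbar X Φ Y (iY := iY) := by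
  refine ⟨2 * L + A, rfl, fun X _ _ Φ hΦ hqi => ?_⟩
  have hL0 : 0 < L := by linarith
  let iY := cylinderMetricSpace hL0 hL0 hΦ
  have hedist (p) : edist (Sum.inl (Φ p) : X ⊕ EuclideanSpace ℝ (Fin n)) (Sum.inr p) ≤
      ENNReal.ofReal L := by
    rw [edist_dist]
    change ENNReal.ofReal (dist (Φ p) (Φ p) + L) ≤ _
    simp
  refine ⟨X ⊕ EuclideanSpace ℝ (Fin n), iY, Sum.inl, Sum.elim id Φ, Sum.inr,
    isBilipEmb_of_dist_eq (by linarith) fun _ _ => rfl, fun a b => ?_, fun _ => rfl,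
    fun p q => ⟨le_min ?_ ?_, (min_le_left _ _).trans ?_⟩, ?_, ?_⟩
  · exact (dist_collapse_le_cylinderDist hL0.le hΦ a b).trans
      (le_mul_of_one_le_left (dist_nonneg (x := a) (y := b)) hL)
  · gcongr
    exact (inv_le_one_of_one_le₀ (by linarith)).trans hL
  · exact inv_mul_le_of_inv_mul_sub_le hL0 hA dist_nonneg (hqi p q).1
  · gcongr
    linarith
  · apply Metric.hausdorffEDist_le_of_mem_edist
    · rintro _ ⟨_, ⟨p, rfl⟩, rfl⟩
      exact ⟨_, ⟨p, rfl⟩, hedist p⟩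
    · rintro _ ⟨p, rfl⟩
      exact ⟨_, ⟨_, ⟨p, rfl⟩, rfl⟩, (edist_comm _ _).trans_le (hedist p)⟩
  · apply Metric.hausdorffEDist_le_of_mem_edist
    · exact fun y _ => ⟨y, mem_univ y, by simp⟩
    · rintro (x | p) -
      · exact ⟨_, ⟨x, rfl⟩, by simp⟩
      · exact ⟨_, ⟨Φ p, rfl⟩, (edist_comm _ _).trans_le (hedist p)⟩
end

section
/- Let X be a length space and let Φ : ℝⁿ → X be an L-Lipschitz map (L ≥ 1, A ≥ 0) which is also an (L,A)-quasi-isometric embedding, with image Q = Φ(ℝⁿ). Then there exist constants λ₁, λ₂ > 0 depending only on L, A and n, and a λ₁-Lipschitz map π : X → X with π(X) ⊆ Q and d(x, π(x)) ≤ λ₂ for every x ∈ Q; that is, π is a λ₁-Lipschitz quasi-retraction of X onto the quasiflat Q whose restriction to Q has displacement at most λ₂. -/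
open Metric Set

/-- Every pseudometric space contains an `ε`-separated `ε`-net. -/
theorem exists_separated_net (X : Type*) [PseudoMetricSpace X] {ε : ℝ} (hε : 0 ≤ ε) :
    ∃ N : Set X, N.Pairwise (fun x y ↦ ε < dist x y) ∧ ∀ x, ∃ y ∈ N, dist x y ≤ ε := by
  lift ε to NNReal using hε
  obtain ⟨N, hN⟩ := zorn_subset {N : Set X | N ⊆ univ ∧ IsSeparated (ε : ENNReal) N}
    fun c hc hchain ↦ ⟨⋃₀ c, ⟨subset_univ _,
      (pairwise_sUnion hchain.directedOn).2 fun s hs ↦ (hc hs).2⟩, fun s ↦ subset_sUnion_of_mem⟩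
  refine ⟨N, fun x hx y hy hxy ↦ ?_, fun x ↦ ?_⟩
  · have h : (ε : ENNReal) < edist x y := hN.prop.2 hx hy hxy
    rw [edist_nndist] at h
    exact_mod_cast h
  · simpa using (IsCover.of_maximal_isSeparated hN).subset_iUnion_closedBall (mem_univ x)

/-- At scales at least `2LA`, a quasi-isometric embedding expands distances up to the
factor `2L`. -/
theorem IsQIEmb.dist_le_two_mul {X Y : Type*} [PseudoMetricSpace X] [PseudoMetricSpace Y]
    {L A : ℝ} {f : X → Y} (hf : IsQIEmb L A f) (hL : 0 < L) {p q : X}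
    (h : 2 * L * A ≤ dist p q) : dist p q ≤ 2 * L * dist (f p) (f q) := by
  have h₁ := mul_le_mul_of_nonneg_left (hf p q).1 hL.le
  rw [mul_sub, mul_inv_cancel_left₀ hL.ne'] at h₁
  linarith

/-- A Lipschitz quasiflat `Q = Φ(ℝⁿ)` in a length space admits a Lipschitz
quasi-retraction `π : X → Q` whose restriction to `Q` has uniformly bounded displacement,
with constants depending only on `L`, `A` and `n`. -/
theorem quasi_retraction_onto_lipschitz_quasiflat (n : ℕ) (L A : ℝ) (hL : 1 ≤ L) (hA : 0 ≤ A) :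
    ∃ lam₁ lam₂ : ℝ, 0 < lam₁ ∧ 0 < lam₂ ∧
      ∀ (X : Type) [MetricSpace X], IsLengthSpace X →
        ∀ Φ : EuclideanSpace ℝ (Fin n) → X,
          (∀ x y, dist (Φ x) (Φ y) ≤ L * dist x y) →
          IsQIEmb L A Φ →
          ∃ π : X → X,
            (∀ x y : X, dist (π x) (π y) ≤ lam₁ * dist x y) ∧
            (∀ x : X, π x ∈ Set.range Φ) ∧
            (∀ x ∈ Set.range Φ, dist x (π x) ≤ lam₂) := by
  have hL₀ : 0 < L := by linarith
  have hδ : 0 ≤ 2 * L * A := by positivity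
  set C : NNReal := lipschitzExtensionConstant (EuclideanSpace ℝ (Fin n))
  have hC : 0 < (C : ℝ) := mod_cast lipschitzExtensionConstant_pos _
  set M : ℝ := L * (C * (2 * L)) with hM
  have hM₀ : 0 < M := by positivity
  refine ⟨M, (1 + M) * (L * (2 * L * A)) + 1, hM₀, by positivity, ?_⟩
  intro X _ _ Φ hΦ hqi
  obtain ⟨N, hsep, hcov⟩ := exists_separated_net (EuclideanSpace ℝ (Fin n)) hδ
  have hexp : ∀ p ∈ N, ∀ q ∈ N, dist p q ≤ 2 * L * dist (Φ p) (Φ q) := by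
    intro p hp q hq
    rcases eq_or_ne p q with rfl | hpq
    · simp
    · exact hqi.dist_le_two_mul hL₀ (hsep hp hq hpq).le
  have hinj : InjOn Φ N := fun p hp q hq h ↦ by
    have := hexp p hp q hq
    rw [h, dist_self, mul_zero] at this
    exact dist_le_zero.1 this
  have hinv : LipschitzOnWith ⟨2 * L, by positivity⟩ (Function.invFunOn Φ N) (Φ '' N) := by
    refine LipschitzOnWith.of_dist_le_mul ?_
    rintro _ ⟨p, hp, rfl⟩ _ ⟨q, hq, rfl⟩
    rw [hinj.leftInvOn_invFunOn hp, hinj.leftInvOn_invFunOn hq]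
    exact hexp p hp q hq
  obtain ⟨g, hg, hgeq⟩ := hinv.extend_finite_dimension
  have hπ : ∀ x y, dist (Φ (g x)) (Φ (g y)) ≤ M * dist x y := fun x y ↦ by
    rw [hM, mul_assoc]
    exact (hΦ _ _).trans (mul_le_mul_of_nonneg_left (hg.dist_le_mul x y) hL₀.le)
  refine ⟨fun x ↦ Φ (g x), hπ, fun x ↦ mem_range_self _, ?_⟩
  rintro _ ⟨p, rfl⟩
  obtain ⟨q, hq, hpq⟩ := hcov p
  have hfix : g (Φ q) = q := by
    rw [← hgeq (mem_image_of_mem Φ hq), hinj.leftInvOn_invFunOn hq]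
  have hd : dist (Φ p) (Φ q) ≤ L * (2 * L * A) :=
    (hΦ p q).trans (mul_le_mul_of_nonneg_left hpq hL₀.le)
  have hd' := hπ (Φ q) (Φ p)
  rw [hfix, dist_comm (Φ q) (Φ p)] at hd'
  have htri := dist_triangle (Φ p) (Φ q) (Φ (g (Φ p)))
  have hscale := mul_le_mul_of_nonneg_left hd hM₀.le
  linarith
end

section
/- For all L ≥ 1, A ≥ 0, A₁ ≥ 0, A₂ ≥ 0 and every integer n ≥ 1 there exists a constant C, depending only on L, A, A₁, A₂ and n, with the following property. Let X be any metric space and let D and D' be two n-dimensional (L,A)-quasidisks in X, i.e. D = q(B) and D' = q'(B') for (L,A)-quasi-isometric embeddings q : B → X and q' : B' → X of closed balls B, B' ⊆ ℝⁿ, with boundaries ∂D = q(∂B) and ∂D' = q'(∂B') the images of the boundary spheres. If the Hausdorff distance satisfies d_H(∂D, ∂D') ≤ A₁ and D is contained in the closed A₂-neighborhood N_{A₂}(D') of D', then d_H(D, D') ≤ C. -/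
open Metric Set

/-- `f` is an `(L,A)`-quasi-isometric embedding on the subset `s`. -/
def IsQIEmbOn {X Y : Type*} [PseudoMetricSpace X] [PseudoMetricSpace Y]
    (L A : ℝ) (f : X → Y) (s : Set X) : Prop :=
  ∀ x ∈ s, ∀ y ∈ s,
    L⁻¹ * dist x y - A ≤ dist (f x) (f y) ∧ dist (f x) (f y) ≤ L * dist x y + A

open Polynomial in
/-- Extrapolation: on polynomials of bounded degree, evaluation at `1` is a fixed linear
combination of evaluations at points of `[0, ε]`. -/
lemma exists_extrapolation_weights (d : ℕ) {ε : ℝ} (hε : 0 < ε) :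
    ∃ w τ : ℕ → ℝ, (∀ i, 0 ≤ τ i ∧ τ i ≤ ε) ∧ ∀ p : ℝ[X], p.natDegree ≤ d →
      p.eval 1 = ∑ i ∈ Finset.range (d + 1), w i * p.eval (τ i) := by
  set τ : ℕ → ℝ := fun i ↦ ε / (i + 1) with hτ
  refine ⟨fun i ↦ (Lagrange.basis (Finset.range (d + 1)) τ i).eval 1, τ, fun i ↦ ⟨by positivity,
    div_le_self hε.le (by simp)⟩, fun p hp ↦ ?_⟩
  have hinj : Set.InjOn τ (Finset.range (d + 1) : Set ℕ) := by
    intro i _ j _ hij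
    simp only [hτ] at hij
    field_simp at hij
    have : (i : ℝ) = j := by linarith
    exact_mod_cast this
  have hdeg : p.degree < (Finset.range (d + 1)).card := by
    rw [Finset.card_range]
    exact lt_of_le_of_lt degree_le_natDegree (by exact_mod_cast Nat.lt_succ_of_le hp)
  conv_lhs => rw [Lagrange.eq_interpolate hinj hdeg]
  simp [Lagrange.interpolate_apply, eval_finsetSum, mul_comm]

section Degree

open MeasureTheory Polynomial

variable {E : Type*} [NormedAddCommGroup E]

lemma det_one_add_pos [NormedSpace ℝ E] [FiniteDimensional ℝ E] {T : E →L[ℝ] E}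
    (hT : ‖T‖ < 1) : 0 < (1 + T).det := by
  have hne : ∀ s ∈ Set.Icc (0 : ℝ) 1, (1 + s • T).det ≠ 0 := by
    intro s hs
    have hlt : ‖-(s • T)‖ < 1 := by
      rw [norm_neg, norm_smul, Real.norm_of_nonneg hs.1]
      exact lt_of_le_of_lt (mul_le_of_le_one_left (norm_nonneg _) hs.2) hT
    have hu : IsUnit (1 + s • T) := by
      simpa using isUnit_one_sub_of_norm_lt_one hlt
    have hu' := hu.map (ContinuousLinearMap.toLinearMapRingHom (R₁ := ℝ) (M₁ := E))
    exact (LinearMap.isUnit_iff_isUnit_det _).1 hu' |>.ne_zero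
  by_contra! hle
  have hcont : ContinuousOn (fun s : ℝ ↦ (1 + s • T).det) (Set.Icc 0 1) :=
    (ContinuousLinearMap.continuous_det.comp (by fun_prop)).continuousOn
  obtain ⟨s, hs, hs0⟩ := intermediate_value_Icc' zero_le_one hcont
    (show (0 : ℝ) ∈ Set.Icc _ _ from ⟨by simpa using hle, by
      simp [ContinuousLinearMap.det]⟩)
  exact hne s hs hs0

lemma exists_polynomial_eval_det [NormedSpace ℝ E] [FiniteDimensional ℝ E] (T : E →L[ℝ] E) :
    ∃ p : ℝ[X], p.natDegree ≤ Module.finrank ℝ E ∧ ∀ t : ℝ, p.eval t = (1 + t • T).det := by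
  classical
  let b := Module.finBasis ℝ E
  let M := LinearMap.toMatrix b b (T : E →ₗ[ℝ] E)
  refine ⟨((X : ℝ[X]) • M.map C + (1 : Matrix _ _ ℝ).map C).det, ?_, fun t ↦ ?_⟩
  · simpa using natDegree_det_X_add_C_le M 1
  · have hdet : (1 + t • T).det = (t • M + 1).det := by
      rw [ContinuousLinearMap.det, ← LinearMap.det_toMatrix b]
      congr 1
      rw [show ((1 + t • T : E →L[ℝ] E) : E →ₗ[ℝ] E) = t • (T : E →ₗ[ℝ] E) + 1 from
        (add_comm _ _).trans rfl, map_add, map_smul, LinearMap.toMatrix_one]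
    rw [hdet, ← coe_evalRingHom, RingHom.map_det]
    congr 1
    ext i j
    by_cases hij : i = j <;> (simp [hij]; ring)

lemma exists_polynomial_eval_norm_sq [InnerProductSpace ℝ E] (x v : E) (c : ℝ) (k : ℕ) :
    ∃ p : ℝ[X], p.natDegree ≤ 2 * k ∧ ∀ t : ℝ, p.eval t = (1 - c * ‖x + t • v‖ ^ 2) ^ k := by
  refine ⟨(C (1 - c * ‖x‖ ^ 2) - C (2 * c * inner ℝ x v) * X - C (c * ‖v‖ ^ 2) * X ^ 2) ^ k, ?_,
    fun t ↦ ?_⟩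
  · rw [mul_comm 2 k]
    refine natDegree_pow_le_of_le k ?_
    compute_degree
  · rw [norm_add_sq_real, norm_smul, inner_smul_right, mul_pow, Real.norm_eq_abs, sq_abs]
    simp
    ring

variable [InnerProductSpace ℝ E] {g : E → E} {K : NNReal} {R t : ℝ}

lemma injective_add_smul (hg : LipschitzWith K g) (ht : 0 ≤ t) (htK : t * K < 1) :
    Function.Injective fun x ↦ x + t • g x := by
  intro x y hxy
  have h1 : x - y = t • (g y - g x) := by
    rw [smul_sub, sub_eq_sub_iff_add_eq_add, add_comm (t • g y)]; exact hxy
  have h2 : ‖x - y‖ ≤ t * K * ‖x - y‖ := by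
    conv_lhs => rw [h1, norm_smul, Real.norm_of_nonneg ht, norm_sub_rev]
    rw [mul_assoc]
    exact mul_le_mul_of_nonneg_left (hg.norm_sub_le x y) ht
  have h3 : ‖x - y‖ = 0 := by nlinarith [norm_nonneg (x - y)]
  exact sub_eq_zero.1 (norm_eq_zero.1 h3)

variable [FiniteDimensional ℝ E]

lemma image_closedBall_add_smul (hg : LipschitzWith K g)
    (hsupp : ∀ x, R < ‖x‖ → g x = 0) (ht : 0 ≤ t) (htK : t * K < 1) :
    (fun x ↦ x + t • g x) '' Metric.closedBall 0 R = Metric.closedBall 0 R := by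
  apply Set.Subset.antisymm
  · rintro _ ⟨x, hx, rfl⟩
    by_contra hy
    simp only [mem_closedBall_zero_iff, not_le] at hx hy
    have : x + t • g x = x := injective_add_smul hg ht htK (by simp [hsupp _ hy])
    rw [this] at hy
    exact absurd hx hy.not_ge
  · intro y hy
    have hc : ContractingWith (t.toNNReal * K) fun x ↦ y - t • g x := by
      refine ⟨by rw [← NNReal.coe_lt_coe]; simpa [ht] using htK, LipschitzWith.of_dist_le_mul
        fun a b ↦ ?_⟩
      rw [dist_sub_left, dist_smul₀, Real.norm_of_nonneg ht]
      simp only [NNReal.coe_mul, Real.coe_toNNReal _ ht, mul_assoc]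
      exact mul_le_mul_of_nonneg_left (hg.dist_le_mul a b) ht
    obtain ⟨x, hx, -⟩ := hc.exists_fixedPoint y (edist_ne_top _ _)
    have hx' : x + t • g x = y := by
      nth_rewrite 1 [← hx.eq]; simp
    refine ⟨x, ?_, hx'⟩
    by_contra hxR
    simp only [mem_closedBall_zero_iff, not_le] at hxR hy
    rw [hsupp x hxR] at hx'
    simp only [smul_zero, add_zero] at hx'
    rw [hx'] at hxR
    exact absurd hy hxR.not_ge

lemma setIntegral_comp_add_smul_mul_det [MeasurableSpace E] [BorelSpace E]
    (hg1 : ContDiff ℝ 1 g) (hg : LipschitzWith K g)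
    (hsupp : ∀ x, R < ‖x‖ → g x = 0) (ht : 0 ≤ t) (htK : t * K < 1) (φ : E → ℝ) :
    ∫ x in Metric.closedBall 0 R, φ (x + t • g x) * (1 + t • fderiv ℝ g x).det =
      ∫ x in Metric.closedBall (0 : E) R, φ x := by
  conv_rhs => rw [← image_closedBall_add_smul hg hsupp ht htK]
  rw [integral_image_eq_integral_abs_det_fderiv_smul volume Metric.isClosed_closedBall.measurableSet
    (f' := fun x ↦ 1 + t • fderiv ℝ g x) _ (injective_add_smul hg ht htK).injOn]
  · refine integral_congr_ae (Filter.Eventually.of_forall fun x ↦ ?_)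
    have : 0 < (1 + t • fderiv ℝ g x).det := by
      apply det_one_add_pos
      rw [norm_smul, Real.norm_of_nonneg ht]
      exact lt_of_le_of_lt (mul_le_mul_of_nonneg_left (norm_fderiv_le_of_lipschitz ℝ hg) ht) htK
    simp only [abs_of_pos this, smul_eq_mul, mul_comm]
  · intro x _
    exact ((hasFDerivAt_id x).add
      ((hg1.differentiable one_ne_zero x).hasFDerivAt.const_smul t)).hasFDerivWithinAt

/-- The change of variables formula for `id + g`, tested against powers of `1 - c ‖·‖²`. -/
lemma setIntegral_pow_comp_mul_det [MeasurableSpace E] [BorelSpace E]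
    (hg1 : ContDiff ℝ 1 g) (hg : LipschitzWith K g)
    (hsupp : ∀ x, R < ‖x‖ → g x = 0) (c : ℝ) (k : ℕ) :
    ∫ x in Metric.closedBall 0 R, (1 - c * ‖x + g x‖ ^ 2) ^ k * (1 + fderiv ℝ g x).det =
      ∫ x in Metric.closedBall (0 : E) R, (1 - c * ‖x‖ ^ 2) ^ k := by
  obtain ⟨w, τ, hτ, hw⟩ := exists_extrapolation_weights (2 * k + Module.finrank ℝ E)
    (ε := 1 / (K + 1)) (by positivity)
  have hpoly : ∀ x, (1 - c * ‖x + g x‖ ^ 2) ^ k * (1 + fderiv ℝ g x).det =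
      ∑ i ∈ Finset.range (2 * k + Module.finrank ℝ E + 1),
        w i * ((1 - c * ‖x + τ i • g x‖ ^ 2) ^ k * (1 + τ i • fderiv ℝ g x).det) := by
    intro x
    obtain ⟨p, hp, hpe⟩ := exists_polynomial_eval_norm_sq x (g x) c k
    obtain ⟨q, hq, hqe⟩ := exists_polynomial_eval_det (fderiv ℝ g x)
    have := hw (p * q) (natDegree_mul_le.trans (add_le_add hp hq))
    simpa [hpe, hqe] using this
  have hcont : Continuous (fderiv ℝ g) := hg1.continuous_fderiv one_ne_zero
  have hgc : Continuous g := hg1.continuous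
  have hint : ∀ i, IntegrableOn (fun x ↦ w i * ((1 - c * ‖x + τ i • g x‖ ^ 2) ^ k *
      (1 + τ i • fderiv ℝ g x).det)) (Metric.closedBall 0 R) := by
    intro i
    have : Continuous fun x ↦ (1 + τ i • fderiv ℝ g x).det :=
      ContinuousLinearMap.continuous_det.comp (by fun_prop)
    exact (by fun_prop : Continuous _).continuousOn.integrableOn_compact (isCompact_closedBall _ _)
  have hτK : ∀ i, τ i * K < 1 := by
    intro i
    calc τ i * K ≤ 1 / (K + 1) * K := mul_le_mul_of_nonneg_right (hτ i).2 K.coe_nonneg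
      _ < 1 := by
        rw [one_div_mul_eq_div, div_lt_one (by positivity)]; linarith
  simp_rw [hpoly]
  rw [integral_finsetSum _ fun i _ ↦ hint i]
  simp_rw [integral_const_mul]
  have hone := hw 1 (by simp)
  simp only [eval_one, mul_one] at hone
  rw [Finset.sum_congr rfl fun i _ ↦ by
    rw [setIntegral_comp_add_smul_mul_det hg1 hg hsupp (hτ i).1 (hτK i)
      fun y ↦ (1 - c * ‖y‖ ^ 2) ^ k], ← Finset.sum_mul, ← hone, one_mul]

/-- A `C¹` self-map of a Euclidean space which is the identity outside a ball has values
arbitrarily close to `0`. -/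
lemma exists_norm_lt_of_eq_id_outside {G : E → E} (hG : ContDiff ℝ 1 G)
    (hsupp : ∀ x, R < ‖x‖ → G x = x) {c : ℝ} (hc : 0 < c) : ∃ x, ‖G x‖ < c := by
  borelize E
  by_contra! hGc
  set g : E → E := fun x ↦ G x - x with hgdef
  have hg1 : ContDiff ℝ 1 g := hG.sub contDiff_id
  have hgs : ∀ x, R < ‖x‖ → g x = 0 := fun x hx ↦ by simp [hgdef, hsupp x hx]
  have hgcs : HasCompactSupport g :=
    HasCompactSupport.intro (isCompact_closedBall 0 R) fun x hx ↦ hgs x (by simpa using hx)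
  obtain ⟨K, hK⟩ := hg1.lipschitzWith_of_hasCompactSupport hgcs one_ne_zero
  set r := max R c
  have hrs : ∀ x, r < ‖x‖ → g x = 0 := fun x hx ↦ hgs x ((le_max_left _ _).trans_lt hx)
  obtain ⟨B, hB⟩ := (isCompact_closedBall (0 : E) r).exists_bound_of_continuousOn
    hG.continuous.continuousOn
  set m := max B r
  have hcm : c ≤ m := (le_max_right R c).trans (le_max_right B r)
  have hm : 0 < m := hc.trans_le hcm
  set κ := 1 / m ^ 2
  have hκ : 0 < κ := by positivity
  have hκm : ∀ s, 0 ≤ s → s ≤ m → κ * s ^ 2 ≤ 1 := fun s hs hsm ↦ by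
    rw [one_div_mul_eq_div, div_le_one (by positivity)]
    gcongr
  set a := 1 - κ * c ^ 2
  set b := 1 - κ * (c / 2) ^ 2
  have ha : 0 ≤ a := sub_nonneg.2 (hκm c hc.le hcm)
  have hab : a < b := by
    have : 0 < κ * c ^ 2 := by positivity
    simp only [a, b, div_pow]
    linarith
  have hb : 0 < b := ha.trans_lt hab
  set J := ∫ x in Metric.closedBall (0 : E) r, |(1 + fderiv ℝ g x).det|
  have hJ : 0 ≤ J := integral_nonneg fun x ↦ abs_nonneg _
  set v := volume.real (Metric.closedBall (0 : E) (c / 2))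
  have hv : 0 < v := by
    simp only [v]
    exact ENNReal.toReal_pos (Metric.measure_closedBall_pos _ _ (by positivity)).ne'
      measure_closedBall_lt_top.ne
  have hdetc : Continuous fun x ↦ (1 + fderiv ℝ g x).det :=
    ContinuousLinearMap.continuous_det.comp
      (continuous_const.add (hg1.continuous_fderiv one_ne_zero))
  have hK1 : ∀ k : ℕ, b ^ k * v ≤ a ^ k * J := by
    intro k
    calc b ^ k * v = ∫ x in Metric.closedBall (0 : E) (c / 2), b ^ k := by
          simp [v, mul_comm]
      _ ≤ ∫ x in Metric.closedBall (0 : E) (c / 2), (1 - κ * ‖x‖ ^ 2) ^ k := by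
          refine setIntegral_mono_on (integrableOn_const measure_closedBall_lt_top.ne)
            ((by fun_prop : Continuous _).continuousOn.integrableOn_compact
              (isCompact_closedBall _ _)) Metric.isClosed_closedBall.measurableSet fun x hx ↦ ?_
          rw [mem_closedBall_zero_iff] at hx
          simp only [b]
          gcongr
      _ ≤ ∫ x in Metric.closedBall (0 : E) r, (1 - κ * ‖x‖ ^ 2) ^ k := by
          refine setIntegral_mono_set
            ((by fun_prop : Continuous _).continuousOn.integrableOn_compact
              (isCompact_closedBall _ _)) ?_ (Metric.closedBall_subset_closedBall
                (by linarith [le_max_right R c])).eventuallyLE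
          refine ae_restrict_of_forall_mem Metric.isClosed_closedBall.measurableSet fun x hx ↦ ?_
          rw [mem_closedBall_zero_iff] at hx
          exact pow_nonneg (sub_nonneg.2 (hκm _ (norm_nonneg _) (hx.trans (le_max_right _ _)))) _
      _ = ∫ x in Metric.closedBall (0 : E) r,
            (1 - κ * ‖x + g x‖ ^ 2) ^ k * (1 + fderiv ℝ g x).det :=
          (setIntegral_pow_comp_mul_det hg1 hK hrs κ k).symm
      _ ≤ ∫ x in Metric.closedBall (0 : E) r, a ^ k * |(1 + fderiv ℝ g x).det| := by
          have hgc := hg1.continuous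
          refine setIntegral_mono_on
            ((by fun_prop : Continuous _).continuousOn.integrableOn_compact
              (isCompact_closedBall _ _))
            ((by fun_prop : Continuous _).continuousOn.integrableOn_compact
              (isCompact_closedBall _ _)) Metric.isClosed_closedBall.measurableSet fun x hx ↦ ?_
          have hxG : x + g x = G x := by simp [hgdef]
          have h0 : 0 ≤ 1 - κ * ‖G x‖ ^ 2 :=
            sub_nonneg.2 (hκm _ (norm_nonneg _) ((hB x hx).trans (le_max_left _ _)))
          rw [hxG]
          calc (1 - κ * ‖G x‖ ^ 2) ^ k * (1 + fderiv ℝ g x).det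
              ≤ (1 - κ * ‖G x‖ ^ 2) ^ k * |(1 + fderiv ℝ g x).det| := by
                gcongr
                exact le_abs_self _
            _ ≤ a ^ k * |(1 + fderiv ℝ g x).det| := by
                simp only [a]
                gcongr
                exact hGc x
      _ = a ^ k * J := integral_const_mul _ _
  obtain ⟨k, hk⟩ := exists_pow_lt_of_lt_one (show 0 < v / (J + 1) by positivity)
    ((div_lt_one hb).2 hab)
  rw [div_pow, div_lt_div_iff₀ (by positivity) (by positivity)] at hk
  nlinarith [hK1 k, pow_nonneg ha k]

end Degree

section CoarseTopology

open Topology Manifold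

variable {E : Type*} [NormedAddCommGroup E] [InnerProductSpace ℝ E]

/-- A coarse no-retraction theorem: a coarsely continuous map from a ball to the complement of its
interior cannot be close to the identity on the boundary sphere. -/
lemma exists_lt_dist_of_coarse_retraction [FiniteDimensional ℝ E] {c : E} {ρ δ : ℝ} (hρ : 0 < ρ)
    (hδ : 0 < δ) {ψ : E → E} (hψ : ∀ x ∈ closedBall c ρ, ρ ≤ dist (ψ x) c)
    (hcont : ∀ x ∈ closedBall c ρ, ∀ y ∈ closedBall c ρ, dist x y ≤ δ →
      dist (ψ x) (ψ y) ≤ ρ / 4) :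
    ∃ x ∈ sphere c ρ, ρ / 4 < dist (ψ x) x := by
  classical
  by_contra! hid
  let Ψ : E → E := fun x ↦ if x ∈ closedBall c ρ then ψ x else x
  let T : E → Set E := fun x ↦ if 2 * ρ < dist x c then {x} else closedBall (Ψ x) (ρ / 2)
  have hTconv : ∀ x, Convex ℝ (T x) := by
    intro x
    simp only [T]
    split_ifs
    exacts [convex_singleton x, convex_closedBall _ _]
  have hTself : ∀ x, ρ < dist x c → x ∈ T x := by
    intro x hx
    simp only [T, Ψ, mem_closedBall, hx.not_ge, if_false]
    split_ifs
    exacts [rfl, mem_closedBall_self (by positivity)]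
  have hloc : ∀ x : E, ∃ U ∈ 𝓝 x, ∃ g : E → E, ContMDiffOn 𝓘(ℝ, E) 𝓘(ℝ, E) 1 g U ∧
      ∀ y ∈ U, g y ∈ T y := by
    intro x
    rcases lt_or_ge ρ (dist x c) with hx | hx
    · refine ⟨{y | ρ < dist y c}, (isOpen_lt continuous_const (by fun_prop)).mem_nhds hx, id,
        contMDiffOn_id, fun y hy ↦ hTself y hy⟩
    · refine ⟨ball x (min δ (ρ / 4)) ∩ {y | dist x c < ρ → dist y c < ρ},
        Filter.inter_mem (ball_mem_nhds _ (by positivity)) ?_, fun _ ↦ ψ x, contMDiffOn_const, ?_⟩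
      · rcases hx.lt_or_eq with hx | hx
        · filter_upwards [(isOpen_lt (continuous_id.dist continuous_const)
            continuous_const).mem_nhds hx] with y hy _ using hy
        · simp [hx]
      · rintro y ⟨hy, hyc⟩
        rw [mem_ball, lt_min_iff] at hy
        have h2 : ¬ 2 * ρ < dist y c := by linarith [dist_triangle y x c]
        simp only [T, h2, if_false, Ψ, mem_closedBall]
        split_ifs with hyB
        · linarith [hcont x hx y hyB (by rw [dist_comm]; exact hy.1.le)]
        · have hxS : dist x c = ρ := hx.antisymm (not_lt.1 fun h ↦ hyB (hyc h).le)
          have := hid x hxS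
          have := dist_triangle (ψ x) x y
          rw [dist_comm x y] at this
          linarith
  obtain ⟨g, hg⟩ := exists_contMDiffMap_forall_mem_convex_of_local 𝓘(ℝ, E) hTconv hloc
  have hg1 : ContDiff ℝ 1 g := g.contMDiff.contDiff
  obtain ⟨x, hx⟩ := exists_norm_lt_of_eq_id_outside (R := 2 * ρ) (c := ρ / 2)
    (G := fun x ↦ g (x + c) - c) ((hg1.comp (contDiff_id.add contDiff_const)).sub contDiff_const)
    (fun x hx ↦ by
      have := hg (x + c)
      simp only [T, dist_eq_norm, add_sub_cancel_right, hx, if_true, mem_singleton_iff] at this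
      simp [this]) (by positivity)
  rw [← dist_eq_norm] at hx
  have hgx := hg (x + c)
  have hΨ : ρ ≤ dist (Ψ (x + c)) c := by
    simp only [Ψ]
    split_ifs with h
    · exact hψ _ h
    · rw [mem_closedBall, not_le] at h; exact h.le
  simp only [T] at hgx
  split_ifs at hgx with h
  · rw [mem_singleton_iff] at hgx
    rw [hgx] at hx
    linarith
  · rw [mem_closedBall] at hgx
    have := dist_triangle_left (Ψ (x + c)) c (g (x + c))
    linarith

lemma norm_inv_norm_smul_sub_le {v w : E} {R : ℝ} (hR : 0 < R) (hv : R ≤ ‖v‖) (hw : R ≤ ‖w‖) :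
    ‖‖v‖⁻¹ • v - ‖w‖⁻¹ • w‖ ≤ 2 / R * ‖v - w‖ := by
  have hv0 : 0 < ‖v‖ := hR.trans_le hv
  have hw0 : 0 < ‖w‖ := hR.trans_le hw
  have h1 : ‖v‖⁻¹ • v - ‖w‖⁻¹ • w = ‖v‖⁻¹ • (v - w) + (‖v‖⁻¹ - ‖w‖⁻¹) • w := by
    rw [smul_sub, sub_smul]; abel
  have h2 : ‖(‖v‖⁻¹ - ‖w‖⁻¹) • w‖ ≤ ‖v‖⁻¹ * ‖v - w‖ := by
    have : ‖v‖⁻¹ - ‖w‖⁻¹ = ‖v‖⁻¹ * (‖w‖ - ‖v‖) * ‖w‖⁻¹ := by field_simp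
    rw [norm_smul, this, norm_mul, norm_mul, norm_inv, norm_inv, norm_norm, norm_norm,
      inv_mul_cancel_right₀ hw0.ne', norm_sub_rev v w]
    exact mul_le_mul_of_nonneg_left (abs_norm_sub_norm_le w v) (by positivity)
  calc _ ≤ ‖‖v‖⁻¹ • (v - w)‖ + ‖(‖v‖⁻¹ - ‖w‖⁻¹) • w‖ := h1 ▸ norm_add_le _ _
    _ ≤ ‖v‖⁻¹ * ‖v - w‖ + ‖v‖⁻¹ * ‖v - w‖ := by
        refine add_le_add ?_ h2
        rw [norm_smul, norm_inv, norm_norm]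
    _ = 2 * ‖v‖⁻¹ * ‖v - w‖ := by ring
    _ ≤ 2 / R * ‖v - w‖ := by
        rw [div_eq_mul_inv]; gcongr

lemma abs_sqrt_sq_add_sub_le {b : ℝ} (hb : 0 ≤ b) (s t : ℝ) :
    |√(s ^ 2 + b) - √(t ^ 2 + b)| ≤ |s - t| := by
  have key : ∀ s t : ℝ, √(s ^ 2 + b) ≤ √(t ^ 2 + b) + |s - t| := by
    intro s t
    rw [Real.sqrt_le_left (by positivity)]
    have h1 : |t| ≤ √(t ^ 2 + b) := Real.abs_le_sqrt (by linarith)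
    have h2 := Real.sq_sqrt (show 0 ≤ t ^ 2 + b by positivity)
    have h3 : t * (s - t) ≤ √(t ^ 2 + b) * |s - t| :=
      (le_abs_self _).trans (by rw [abs_mul]; gcongr)
    nlinarith [sq_abs (s - t)]
  rw [abs_sub_le_iff]
  constructor
  · linarith [key s t]
  · linarith [key t s, abs_sub_comm s t]

/-- The radial projection, from a point `y` of a ball, onto the boundary sphere. -/
lemma exists_radial_projection {c y : E} {ρ R : ℝ} (hy : y ∈ closedBall c ρ) (hR : 0 < R) :
    ∃ r : E → E, (∀ p, R ≤ dist p y → r p ∈ sphere c ρ) ∧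
      (∀ p ∈ sphere c ρ, R ≤ dist p y → r p = p) ∧
      ∀ p p', R ≤ dist p y → R ≤ dist p' y → dist (r p) (r p') ≤ 8 * ρ / R * dist p p' := by
  rw [mem_closedBall, dist_eq_norm] at hy
  set z := y - c with hz
  have hρ : 0 ≤ ρ := (norm_nonneg _).trans hy
  have hb : 0 ≤ ρ ^ 2 - ‖z‖ ^ 2 := sub_nonneg.2 (by gcongr)
  set b := ρ ^ 2 - ‖z‖ ^ 2 with hbdef
  let u : E → E := fun p ↦ ‖p - y‖⁻¹ • (p - y)
  let a : E → ℝ := fun p ↦ inner ℝ z (u p)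
  let τ : E → ℝ := fun p ↦ -a p + √(a p ^ 2 + b)
  have hu : ∀ p, R ≤ dist p y → ‖u p‖ = 1 := fun p hp ↦ by
    rw [dist_eq_norm] at hp
    have : 0 < ‖p - y‖ := hR.trans_le hp
    simp [u, norm_smul, this.ne']
  have hτ0 : ∀ p, 0 ≤ τ p := fun p ↦ by
    have : |a p| ≤ √(a p ^ 2 + b) := Real.abs_le_sqrt (by linarith)
    linarith [le_abs_self (a p)]
  have hsq : ∀ p, τ p ^ 2 + 2 * τ p * a p = b := fun p ↦ by
    have := Real.sq_sqrt (show 0 ≤ a p ^ 2 + b by positivity)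
    simp only [τ]
    linear_combination this
  have hmem : ∀ p, R ≤ dist p y → y + τ p • u p ∈ sphere c ρ := fun p hp ↦ by
    rw [mem_sphere, dist_eq_norm, show y + τ p • u p - c = z + τ p • u p by rw [hz]; abel,
      ← sq_eq_sq₀ (norm_nonneg _) hρ, norm_add_sq_real, norm_smul, hu p hp, inner_smul_right,
      Real.norm_of_nonneg (hτ0 p)]
    linear_combination hsq p + hbdef
  have hτle : ∀ p, R ≤ dist p y → τ p ≤ 2 * ρ := fun p hp ↦ by
    have h1 := mem_sphere.1 (hmem p hp)
    have h2 := dist_triangle_right (y + τ p • u p) y c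
    rw [dist_self_add_left, norm_smul, hu p hp, Real.norm_of_nonneg (hτ0 p), h1,
      dist_eq_norm] at h2
    linarith
  refine ⟨fun p ↦ y + τ p • u p, hmem, fun p hp hpR ↦ ?_, fun p p' hp hp' ↦ ?_⟩
  · rw [dist_eq_norm] at hpR
    set l := ‖p - y‖ with hl
    have hl0 : 0 < l := hR.trans_le hpR
    have hlu : l • u p = p - y := by simp [u, ← hl, smul_smul, hl0.ne']
    have hla : l * a p = inner ℝ z (p - y) := by rw [← hlu, inner_smul_right]
    have hlsq : l ^ 2 + 2 * l * a p = b := by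
      have h1 : ‖z + (p - y)‖ = ρ := by
        rw [← mem_sphere.1 hp, dist_eq_norm]; congr 1; rw [hz]; abel
      have h2 := norm_add_sq_real z (p - y)
      rw [h1, ← hla, ← hl] at h2
      linear_combination hbdef - h2
    have hτl : τ p = l := by
      have h1 : √(a p ^ 2 + b) = l + a p := by
        rw [← hlsq, show a p ^ 2 + (l ^ 2 + 2 * l * a p) = (l + a p) ^ 2 by ring]
        exact Real.sqrt_sq (by nlinarith)
      simp [τ, h1]
    simp only [hτl, hlu, add_sub_cancel]
  · have huu : ‖u p - u p'‖ ≤ 2 / R * dist p p' := by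
      rw [dist_eq_norm] at hp hp'
      simpa [dist_eq_norm] using norm_inv_norm_smul_sub_le hR hp hp'
    have haa : |a p - a p'| ≤ ρ * ‖u p - u p'‖ := by
      simp only [a]
      rw [← inner_sub_right]
      exact (abs_real_inner_le_norm _ _).trans (by gcongr)
    have hττ : |τ p - τ p'| ≤ 2 * (ρ * ‖u p - u p'‖) := by
      have := (abs_sqrt_sq_add_sub_le hb (a p) (a p')).trans haa
      rw [abs_le] at *
      constructor <;> simp only [τ] <;> linarith [this.1, this.2, haa.1, haa.2]
    calc dist (y + τ p • u p) (y + τ p' • u p')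
        = ‖(τ p - τ p') • u p + τ p' • (u p - u p')‖ := by
          rw [dist_add_left, dist_eq_norm, sub_smul, smul_sub]; congr 1; abel
      _ ≤ |τ p - τ p'| * 1 + τ p' * ‖u p - u p'‖ := by
          refine (norm_add_le _ _).trans_eq ?_
          rw [norm_smul _ (u p), norm_smul (τ p'), hu p hp,
            Real.norm_of_nonneg (hτ0 p'), Real.norm_eq_abs]
      _ ≤ 2 * (ρ * ‖u p - u p'‖) * 1 + 2 * ρ * ‖u p - u p'‖ := by
          gcongr
          exact hτle p' hp'
      _ = 4 * ρ * ‖u p - u p'‖ := by ring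
      _ ≤ 4 * ρ * (2 / R * dist p p') := by gcongr
      _ = 8 * ρ / R * dist p p' := by ring

/-- A coarse map between balls which, along the boundary spheres, has a coarsely Lipschitz coarse
inverse `h`, is coarsely surjective. -/
lemma exists_dist_lt_of_coarse_inverse_on_sphere [FiniteDimensional ℝ E] {c c' y : E}
    {ρ ρ' R K k Λ κ : ℝ} (hρ : 0 < ρ) (hR : 0 < R) (hΛ : 0 ≤ Λ) {f h : E → E}
    (hy : y ∈ closedBall c' ρ')
    (hf : ∀ x ∈ closedBall c ρ, ∀ x' ∈ closedBall c ρ, dist x x' ≤ 1 → dist (f x) (f x') ≤ K)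
    (hh : MapsTo h (sphere c' ρ') (sphere c ρ))
    (hhL : ∀ s ∈ sphere c' ρ', ∀ s' ∈ sphere c' ρ', dist (h s) (h s') ≤ Λ * dist s s' + κ)
    (hfh : ∀ x ∈ sphere c ρ, ∃ s ∈ sphere c' ρ', dist (f x) s ≤ k ∧ dist (h s) x ≤ κ)
    (hK : Λ * (8 * ρ' / R * K) + κ ≤ ρ / 4) (hk : Λ * (8 * ρ' / R * k) + 2 * κ ≤ ρ / 4)
    (hk0 : 0 ≤ k) :
    ∃ x ∈ closedBall c ρ, dist (f x) y < R + k := by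
  by_contra! hfar
  have hρ' : 0 ≤ ρ' := dist_nonneg.trans (mem_closedBall.1 hy)
  obtain ⟨r, hrS, hrid, hrL⟩ := exists_radial_projection hy hR
  have hfR : ∀ x ∈ closedBall c ρ, R ≤ dist (f x) y := fun x hx ↦ by linarith [hfar x hx]
  obtain ⟨x, hx, hlt⟩ := exists_lt_dist_of_coarse_retraction (ψ := fun x ↦ h (r (f x))) hρ one_pos
    (fun x hx ↦ (mem_sphere.1 (hh (hrS _ (hfR x hx)))).ge) (fun x hx x' hx' hxx' ↦ by
      calc dist (h (r (f x))) (h (r (f x')))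
          ≤ Λ * dist (r (f x)) (r (f x')) + κ :=
            hhL _ (hrS _ (hfR x hx)) _ (hrS _ (hfR x' hx'))
        _ ≤ Λ * (8 * ρ' / R * K) + κ := by
            gcongr
            refine (hrL _ _ (hfR x hx) (hfR x' hx')).trans ?_
            gcongr
            exact hf x hx x' hx' hxx'
        _ ≤ ρ / 4 := hK)
  have hxB := sphere_subset_closedBall hx
  obtain ⟨s, hs, hfs, hhs⟩ := hfh x hx
  have hsR : R ≤ dist s y := by linarith [hfar x hxB, dist_triangle (f x) s y]
  have hrs : dist (r (f x)) s ≤ 8 * ρ' / R * k := by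
    have := hrL _ _ (hfR x hxB) hsR
    rw [hrid s hs hsR] at this
    refine this.trans ?_
    gcongr
  have h1 := hhL _ (hrS _ (hfR x hxB)) s hs
  have h2 := mul_le_mul_of_nonneg_left hrs hΛ
  linarith [dist_triangle (h (r (f x))) (h s) x]

end CoarseTopology

section Quasidisks

variable {X Y : Type*} [PseudoMetricSpace X] [PseudoMetricSpace Y] {L A : ℝ} {f : X → Y}
  {s : Set X} {x y : X}

lemma IsQIEmbOn.dist_le (hf : IsQIEmbOn L A f s) (hL : 0 < L) (hx : x ∈ s) (hy : y ∈ s) :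
    dist x y ≤ L * (dist (f x) (f y) + A) := by
  rw [← inv_mul_le_iff₀ hL]
  linarith [(hf x hx y hy).1]

lemma IsQIEmbOn.isBounded_image (hf : IsQIEmbOn L A f s) (hL : 0 ≤ L)
    (hs : Bornology.IsBounded s) : Bornology.IsBounded (f '' s) := by
  obtain ⟨M, hM⟩ := isBounded_iff.1 hs
  refine isBounded_iff.2 ⟨L * M + A, ?_⟩
  rintro _ ⟨x, hx, rfl⟩ _ ⟨y, hy, rfl⟩
  refine (hf x hx y hy).2.trans ?_
  gcongr
  exact hM hx hy

/-- A coarse lift `f` of one quasi-isometric embedding through another is coarsely Lipschitz. -/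
lemma IsQIEmbOn.dist_coarse_lift_le {W : Type*} [PseudoMetricSpace W] {p : W → Y} {t : Set W}
    (hf : IsQIEmbOn L A f s) (hp : IsQIEmbOn L A p t) (hL : 0 < L) {M : ℝ} {w w' : W}
    (hx : x ∈ s) (hy : y ∈ s) (hw : w ∈ t) (hw' : w' ∈ t) (h : dist (p w) (f x) ≤ M)
    (h' : dist (p w') (f y) ≤ M) : dist x y ≤ L * (L * dist w w' + 2 * M + 2 * A) := by
  refine (hf.dist_le hL hx hy).trans (mul_le_mul_of_nonneg_left ?_ hL.le)
  have := (hp w hw w' hw').2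
  have h₁ := dist_triangle4 (f x) (p w) (p w') (f y)
  rw [dist_comm (f x) (p w)] at h₁
  linarith

end Quasidisks

/-- Two `n`-dimensional `(L,A)`-quasidisks whose boundaries are at Hausdorff
distance `≤ A₁`, such that the first is contained in the closed `A₂`-neighborhood of the
second, are at Hausdorff distance `≤ C`, where `C` depends only on `L, A, A₁, A₂, n`. -/
theorem quasidisks_with_close_boundaries (n : ℕ) (hn : 1 ≤ n)
    (L A A₁ A₂ : ℝ) (hL : 1 ≤ L) (hA : 0 ≤ A) (hA₁ : 0 ≤ A₁) (hA₂ : 0 ≤ A₂) :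
    ∃ C : ℝ, ∀ (X : Type) [MetricSpace X],
      ∀ (c c' : EuclideanSpace ℝ (Fin n)) (ρ ρ' : ℝ), 0 ≤ ρ → 0 ≤ ρ' →
        ∀ q q' : EuclideanSpace ℝ (Fin n) → X,
          IsQIEmbOn L A q (Metric.closedBall c ρ) →
          IsQIEmbOn L A q' (Metric.closedBall c' ρ') →
          Metric.hausdorffDist (q '' Metric.sphere c ρ) (q' '' Metric.sphere c' ρ') ≤ A₁ →
          q '' Metric.closedBall c ρ ⊆ Metric.cthickening A₂ (q' '' Metric.closedBall c' ρ') →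
          Metric.hausdorffDist (q '' Metric.closedBall c ρ)
            (q' '' Metric.closedBall c' ρ') ≤ C := by
  have : Nonempty (Fin n) := ⟨⟨0, hn⟩⟩
  have hL0 : 0 < L := by linarith
  obtain ⟨M₁, hM₁, hAM₁⟩ : ∃ M₁, 0 < M₁ ∧ A₁ < M₁ := ⟨A₁ + 1, by linarith, by linarith⟩
  obtain ⟨M₂, hM₂, hAM₂⟩ : ∃ M₂, 0 < M₂ ∧ A₂ < M₂ := ⟨A₂ + 1, by linarith, by linarith⟩
  set κ := L * (2 * M₁ + 2 * A) + 1
  have hκ : 1 ≤ κ := by simp only [κ, le_add_iff_nonneg_left]; positivity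
  set K := L * (L * 1 + 2 * M₂ + 2 * A)
  have hK : 0 < K := by positivity
  set k := L * (M₁ + M₂ + A)
  have hk : 0 < k := by positivity
  set P := κ + L ^ 2
  have hP : 0 < P := by positivity
  set R := 64 * L ^ 2 * P * (K + k)
  have hR : 0 < R := by positivity
  refine ⟨M₂ + (M₂ + (L * (R + k) + A)) + (M₁ + (L * (2 * (P * (16 * κ))) + A)), ?_⟩
  intro X _ c c' ρ ρ' hρ hρ' q q' hq hq' hbd hsub
  have hmem₁ : 0 ≤ M₁ + (L * (2 * (P * (16 * κ))) + A) := by positivity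
  have hmem₂ : 0 ≤ M₂ + (L * (R + k) + A) := by positivity
  have hSne : (q '' sphere c ρ).Nonempty := (NormedSpace.sphere_nonempty.2 hρ).image q
  have hSne' : (q' '' sphere c' ρ').Nonempty := (NormedSpace.sphere_nonempty.2 hρ').image q'
  have hfin := hausdorffEDist_ne_top_of_nonempty_of_bounded hSne hSne'
    ((hq.isBounded_image hL0.le isBounded_closedBall).subset
      (image_mono sphere_subset_closedBall))
    ((hq'.isBounded_image hL0.le isBounded_closedBall).subset
      (image_mono sphere_subset_closedBall))
  have hto : ∀ x ∈ sphere c ρ, ∃ s ∈ sphere c' ρ', dist (q x) (q' s) ≤ M₁ := by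
    intro x hx
    obtain ⟨_, ⟨s, hs, rfl⟩, h⟩ := exists_dist_lt_of_hausdorffDist_lt (mem_image_of_mem q hx)
      (hbd.trans_lt hAM₁) hfin
    exact ⟨s, hs, h.le⟩
  have hfrom : ∀ s, ∃ x, s ∈ sphere c' ρ' → x ∈ sphere c ρ ∧ dist (q x) (q' s) ≤ M₁ := by
    intro s
    by_cases hs : s ∈ sphere c' ρ'
    · obtain ⟨_, ⟨x, hx, rfl⟩, h⟩ := exists_dist_lt_of_hausdorffDist_lt'
        (mem_image_of_mem q' hs) (hbd.trans_lt hAM₁) hfin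
      exact ⟨x, fun _ ↦ ⟨hx, h.le⟩⟩
    · exact ⟨c, fun h ↦ absurd h hs⟩
  have hlift : ∀ x, ∃ p, x ∈ closedBall c ρ → p ∈ closedBall c' ρ' ∧ dist (q x) (q' p) ≤ M₂ := by
    intro x
    by_cases hx : x ∈ closedBall c ρ
    · obtain ⟨_, ⟨p, hp, rfl⟩, h⟩ := mem_thickening_iff.1
        (cthickening_subset_thickening' hM₂ hAM₂ _ (hsub (mem_image_of_mem q hx)))
      exact ⟨p, fun _ ↦ ⟨hp, h.le⟩⟩
    · exact ⟨c, fun h ↦ absurd h hx⟩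
  choose h hh using hfrom
  choose f hf using hlift
  have hρρ' : ρ' ≤ κ + L ^ 2 * ρ := by
    obtain ⟨e, he⟩ := exists_norm_eq (EuclideanSpace ℝ (Fin n)) hρ'
    have h1 : c' + e ∈ sphere c' ρ' := by simp [he]
    have h2 : c' - e ∈ sphere c' ρ' := by simp [he]
    have h3 := hq'.dist_coarse_lift_le hq hL0 (sphere_subset_closedBall h1)
      (sphere_subset_closedBall h2) (sphere_subset_closedBall (hh _ h1).1)
      (sphere_subset_closedBall (hh _ h2).1) (hh _ h1).2 (hh _ h2).2
    have h4 : dist (c' + e) (c' - e) = 2 * ρ' := by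
      rw [dist_eq_norm, add_sub_sub_cancel, ← two_smul ℝ, norm_smul, he]; simp
    have h5 : dist (h (c' + e)) (h (c' - e)) ≤ 2 * ρ := by
      linarith [dist_triangle_right (h (c' + e)) (h (c' - e)) c, mem_sphere.1 (hh _ h1).1,
        mem_sphere.1 (hh _ h2).1]
    have h6 := mul_le_mul_of_nonneg_left h5 (sq_nonneg L)
    simp only [κ]
    nlinarith
  refine hausdorffDist_le_of_mem_dist (by positivity) ?_ ?_
  · rintro _ ⟨x, hx, rfl⟩
    exact ⟨_, mem_image_of_mem q' (hf x hx).1, by linarith [(hf x hx).2]⟩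
  rintro _ ⟨y, hy, rfl⟩
  rcases lt_or_ge ρ (16 * κ) with hsmall | hbig
  · obtain ⟨s, hs⟩ := NormedSpace.sphere_nonempty (x := c').2 hρ'
    refine ⟨_, mem_image_of_mem q (sphere_subset_closedBall (hh s hs).1), ?_⟩
    have h1 : dist y s ≤ 2 * (P * (16 * κ)) := by
      have : ρ' ≤ P * (16 * κ) := by
        simp only [P]
        nlinarith [sq_nonneg L]
      linarith [dist_triangle_right y s c', mem_sphere.1 hs, mem_closedBall.1 hy]
    have h2 := (hq' y hy s (sphere_subset_closedBall hs)).2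
    have h3 := mul_le_mul_of_nonneg_left h1 hL0.le
    have h4 := dist_triangle_right (q' y) (q (h s)) (q' s)
    linarith [(hh s hs).2]
  · have hρ1 : 1 ≤ ρ := by linarith
    have hPρ : ρ' ≤ P * ρ := by
      simp only [P]
      nlinarith
    have hsize : ∀ m, 0 ≤ m → m ≤ K + k → L ^ 2 * (8 * ρ' / R * m) ≤ ρ / 8 := by
      intro m hm hmK
      calc L ^ 2 * (8 * ρ' / R * m) ≤ L ^ 2 * (8 * (P * ρ) / R * (K + k)) := by gcongr
        _ = ρ / 8 := by
          simp only [R]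
          have : 0 < K + k := by positivity
          field_simp
          norm_num
    obtain ⟨x, hx, hxy⟩ := exists_dist_lt_of_coarse_inverse_on_sphere (f := f) (h := h) (K := K)
      (Λ := L ^ 2) (κ := κ) (hρ1.trans_lt' one_pos) hR (sq_nonneg L) hy
      (fun x hx x' hx' hxx' ↦ by
        have h1 := hq'.dist_coarse_lift_le hq hL0 (hf x hx).1 (hf x' hx').1 hx hx'
          (hf x hx).2 (hf x' hx').2
        refine h1.trans ?_
        simp only [K]
        gcongr)
      (fun s hs ↦ (hh s hs).1)
      (fun s hs s' hs' ↦ by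
        have h1 := hq.dist_coarse_lift_le hq' hL0 (sphere_subset_closedBall (hh s hs).1)
          (sphere_subset_closedBall (hh s' hs').1) (sphere_subset_closedBall hs)
          (sphere_subset_closedBall hs') ((dist_comm _ _).trans_le (hh s hs).2)
          ((dist_comm _ _).trans_le (hh s' hs').2)
        simp only [κ]
        linarith)
      (fun x hx ↦ by
        have hxB := sphere_subset_closedBall hx
        obtain ⟨s, hs, hxs⟩ := hto x hx
        have hsB := sphere_subset_closedBall hs
        refine ⟨s, hs, (hq'.dist_le hL0 (hf x hxB).1 hsB).trans ?_,
          (hq.dist_le hL0 (sphere_subset_closedBall (hh s hs).1) hxB).trans ?_⟩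
        · simp only [k]
          gcongr
          linarith [dist_triangle_left (q' (f x)) (q' s) (q x), (hf x hxB).2]
        · have h1 : dist (q (h s)) (q x) + A ≤ 2 * M₁ + 2 * A := by
            linarith [dist_triangle_right (q (h s)) (q x) (q' s), (hh s hs).2]
          have := mul_le_mul_of_nonneg_left h1 hL0.le
          simp only [κ]
          linarith)
      (by linarith [hsize K hK.le (by linarith)]) (by linarith [hsize k hk.le (by linarith)]) hk.le
    refine ⟨_, mem_image_of_mem q hx, ?_⟩
    have h1 := (hq' _ (hf x hx).1 y hy).2
    have h2 := mul_le_mul_of_nonneg_left hxy.le hL0.le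
    have h3 := dist_triangle_left (q' y) (q x) (q' (f x))
    rw [dist_comm (q' (f x)) (q x)] at h3
    linarith [(hf x hx).2]
end

section
/- Let n ≥ 1 be an integer, L ≥ 1, A > 0, let X be a metric space and let Φ : ℝⁿ → X be an (L,A)-quasi-isometric embedding with image Q = Φ(ℝⁿ). Let Z = (2LA)·ℤⁿ ⊆ ℝⁿ be the cubical lattice at scale 2LA. Then: (i) the restriction of Φ to Z is a 2L-bilipschitz embedding; and (ii) there exist a constant λ depending only on L, A and n, and a λ-Lipschitz map π : X → ℝⁿ such that π(Φ(z)) = z for every z ∈ Z, |π(Φ(x)) − x| ≤ λ for every x ∈ ℝⁿ, and d(Φ(π(q)), q) ≤ λ for every q ∈ Q (so π is a λ-quasi-retraction associated to Φ). -/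
open Metric Set

/-- The cubical lattice `s·ℤⁿ ⊆ ℝⁿ` at scale `s`. -/
def latticeSet (n : ℕ) (s : ℝ) : Set (EuclideanSpace ℝ (Fin n)) :=
  {x | ∀ i : Fin n, ∃ k : ℤ, x i = s * (k : ℝ)}

open scoped NNReal

/-- McShane's extension theorem for maps into a Euclidean space. -/
theorem LipschitzOnWith.extend_euclidean {α ι : Type*} [PseudoMetricSpace α] [Fintype ι]
    {f : α → EuclideanSpace ℝ ι} {s : Set α} {K : ℝ≥0} (hf : LipschitzOnWith K f s) :
    ∃ g : α → EuclideanSpace ℝ ι,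
      LipschitzWith ((Fintype.card ι : ℝ≥0) ^ (1 / (2 : ENNReal)).toReal * K) g ∧ EqOn f g s := by
  have hf' : LipschitzOnWith K (fun a => WithLp.ofLp (f a)) s := by
    simpa [Function.comp_def] using
      (PiLp.lipschitzWith_ofLp 2 (fun _ : ι => ℝ)).comp_lipschitzOnWith hf
  obtain ⟨g, hg, hfg⟩ := hf'.extend_pi
  refine ⟨fun a => WithLp.toLp 2 (g a),
    (PiLp.lipschitzWith_toLp 2 (fun _ : ι => ℝ)).comp hg, fun a ha => ?_⟩
  simp only [← hfg ha]

/-- Distinct points of the lattice of scale `s` are at distance at least `s`. -/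
theorem le_dist_of_mem_latticeSet {n : ℕ} {s : ℝ} (hs : 0 ≤ s) {z z' : EuclideanSpace ℝ (Fin n)}
    (hz : z ∈ latticeSet n s) (hz' : z' ∈ latticeSet n s) (hne : z ≠ z') : s ≤ dist z z' := by
  obtain ⟨i, hi⟩ : ∃ i, z i ≠ z' i := by
    by_contra! h
    exact hne (PiLp.ext h)
  obtain ⟨k, hk⟩ := hz i
  obtain ⟨m, hm⟩ := hz' i
  have hkm : k - m ≠ 0 := fun h => hi (by rw [hk, hm, sub_eq_zero.mp h])
  have habs : (1 : ℝ) ≤ |(k : ℝ) - m| := by exact_mod_cast Int.one_le_abs hkm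
  calc s ≤ s * |(k : ℝ) - m| := le_mul_of_one_le_right hs habs
    _ = dist (z i) (z' i) := by
      rw [Real.dist_eq, hk, hm, ← mul_sub, abs_mul, abs_of_nonneg hs]
    _ ≤ dist z z' := by
      simpa [dist_eq_norm] using PiLp.norm_apply_le (z - z') i

/-- Every point is within `√n * s` of the lattice of scale `s`. -/
theorem exists_mem_latticeSet_dist_le {n : ℕ} {s : ℝ} (hs : 0 < s)
    (x : EuclideanSpace ℝ (Fin n)) :
    ∃ z ∈ latticeSet n s,
      dist z x ≤ ((Fintype.card (Fin n) : ℝ≥0) ^ (1 / (2 : ENNReal)).toReal : ℝ≥0) * s := by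
  refine ⟨WithLp.toLp 2 fun i => s * ⌊x i / s⌋, fun i => ⟨_, rfl⟩, ?_⟩
  refine ((PiLp.lipschitzWith_toLp 2 (fun _ : Fin n => ℝ)).dist_le_mul _ (WithLp.ofLp x)).trans ?_
  gcongr
  refine (dist_pi_le_iff hs.le).2 fun i => ?_
  have h₁ : s * ⌊x i / s⌋ ≤ x i := by
    simpa [mul_div_cancel₀ _ hs.ne'] using mul_le_mul_of_nonneg_left (Int.floor_le (x i / s)) hs.le
  have h₂ : x i ≤ s * (⌊x i / s⌋ + 1) := by
    rw [← div_le_iff₀' hs]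
    exact (Int.lt_floor_add_one _).le
  rw [Real.dist_eq, abs_le]
  constructor <;> linarith

/-- A quasi-isometric embedding is bilipschitz on any two points that are equal or at distance
at least `2 * L * A`. -/
theorem IsQIEmb.bilipschitz_of_le_dist {X Y : Type*} [PseudoMetricSpace X] [PseudoMetricSpace Y]
    {L A : ℝ} {f : X → Y} (hf : IsQIEmb L A f) (hL : 1 ≤ L) (hA : 0 ≤ A) {x x' : X}
    (h : x ≠ x' → 2 * L * A ≤ dist x x') :
    (2 * L)⁻¹ * dist x x' ≤ dist (f x) (f x') ∧ dist (f x) (f x') ≤ 2 * L * dist x x' := by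
  rcases eq_or_ne x x' with rfl | hne
  · simp
  have hL₀ : 0 < L := by linarith
  have hd := h hne
  obtain ⟨h₁, h₂⟩ := hf x x'
  have hlow : A ≤ (2 * L)⁻¹ * dist x x' := by
    rw [← div_eq_inv_mul, le_div_iff₀ (by positivity)]
    linarith
  have hinv : L⁻¹ * dist x x' = 2 * ((2 * L)⁻¹ * dist x x') := by
    field_simp
  have hup : A ≤ L * dist x x' := by
    nlinarith [mul_nonneg hL₀.le hA, mul_le_mul hL hd (by positivity) hL₀.le]
  constructor <;> linarith

/-- For an `(L,A)`-quasi-isometric embedding `Φ : ℝⁿ → X` with image `Q`: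
(i) the restriction of `Φ` to the lattice `Z = (2LA)·ℤⁿ` is `2L`-bilipschitz, and
(ii) there is a `λ`-Lipschitz quasi-retraction `π : X → ℝⁿ` with `π ∘ Φ = id` on `Z`,
`|π(Φ(x)) − x| ≤ λ` for all `x ∈ ℝⁿ`, and `d(Φ(π(q)), q) ≤ λ` for all `q ∈ Q`,
where `λ` depends only on `L`, `A` and `n`. -/
theorem quasi_retraction_exists (n : ℕ) (hn : 1 ≤ n) (L A : ℝ) (hL : 1 ≤ L) (hA : 0 < A) :
    ∃ lam : ℝ, ∀ (X : Type) [MetricSpace X] (Φ : EuclideanSpace ℝ (Fin n) → X),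
      IsQIEmb L A Φ →
      (∀ z ∈ latticeSet n (2 * L * A), ∀ z' ∈ latticeSet n (2 * L * A),
          (2 * L)⁻¹ * dist z z' ≤ dist (Φ z) (Φ z')
            ∧ dist (Φ z) (Φ z') ≤ (2 * L) * dist z z')
        ∧ ∃ π : X → EuclideanSpace ℝ (Fin n),
            (∀ a b : X, dist (π a) (π b) ≤ lam * dist a b) ∧
            (∀ z ∈ latticeSet n (2 * L * A), π (Φ z) = z) ∧
            (∀ x : EuclideanSpace ℝ (Fin n), dist (π (Φ x)) x ≤ lam) ∧
            (∀ q ∈ Set.range Φ, dist (Φ (π q)) q ≤ lam) := by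
  obtain ⟨c, hc⟩ : ∃ c : ℝ≥0, (Fintype.card (Fin n) : ℝ≥0) ^ (1 / (2 : ENNReal)).toReal = c :=
    ⟨_, rfl⟩
  have hL₀ : 0 < L := by linarith
  have hs : 0 < 2 * L * A := by positivity
  obtain ⟨r, hr_def⟩ : ∃ r : ℝ, r = c * (2 * L * A) := ⟨_, rfl⟩
  obtain ⟨K, hK_def⟩ : ∃ K : ℝ, K = c * (2 * L) := ⟨_, rfl⟩
  obtain ⟨C, hC_def⟩ : ∃ C : ℝ, C = K * (L * r + A) + r := ⟨_, rfl⟩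
  have hr : 0 ≤ r := by rw [hr_def]; positivity
  have hK : 0 ≤ K := by rw [hK_def]; positivity
  have hC : 0 ≤ C := by rw [hC_def]; positivity
  refine ⟨K + C + (L * C + A), fun X _ Φ hΦ => ?_⟩
  have hLC : 0 ≤ L * C + A := by positivity
  have hbil := fun z (hz : z ∈ latticeSet n (2 * L * A)) z' (hz' : z' ∈ latticeSet n (2 * L * A)) =>
    hΦ.bilipschitz_of_le_dist hL hA.le (le_dist_of_mem_latticeSet hs.le hz hz')
  have hanti : ∀ z ∈ latticeSet n (2 * L * A), ∀ z' ∈ latticeSet n (2 * L * A),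
      dist z z' ≤ 2 * L * dist (Φ z) (Φ z') := fun z hz z' hz' =>
    (inv_mul_le_iff₀ (by positivity)).1 (hbil z hz z' hz').1
  have hinj : InjOn Φ (latticeSet n (2 * L * A)) := fun z hz z' hz' h =>
    dist_le_zero.1 (by simpa [h] using hanti z hz z' hz')
  have hlip : LipschitzOnWith (2 * L).toNNReal (Function.invFunOn Φ (latticeSet n (2 * L * A)))
      (Φ '' latticeSet n (2 * L * A)) := by
    refine LipschitzOnWith.of_dist_le_mul ?_
    rintro _ ⟨z, hz, rfl⟩ _ ⟨z', hz', rfl⟩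
    rw [hinj.leftInvOn_invFunOn hz, hinj.leftInvOn_invFunOn hz',
      Real.coe_toNNReal _ (by positivity)]
    exact hanti z hz z' hz'
  obtain ⟨π, hπ, heq⟩ := hlip.extend_euclidean
  have hπK : ∀ a b, dist (π a) (π b) ≤ K * dist a b := fun a b => by
    have h := hπ.dist_le_mul a b
    rwa [hc, NNReal.coe_mul, Real.coe_toNNReal _ (by positivity), ← hK_def] at h
  have hπΦ : ∀ z ∈ latticeSet n (2 * L * A), π (Φ z) = z := fun z hz => by
    rw [← heq (mem_image_of_mem Φ hz), hinj.leftInvOn_invFunOn hz]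
  have hclose : ∀ x, dist (π (Φ x)) x ≤ C := fun x => by
    obtain ⟨z, hz, hzx⟩ := exists_mem_latticeSet_dist_le hs x
    rw [hc, ← hr_def] at hzx
    have hΦr : dist (Φ x) (Φ z) ≤ L * r + A := by
      refine (hΦ x z).2.trans ?_
      rw [dist_comm]
      gcongr
    calc dist (π (Φ x)) x ≤ dist (π (Φ x)) (π (Φ z)) + dist (π (Φ z)) x := dist_triangle _ _ _
      _ ≤ K * (L * r + A) + r := by
        refine add_le_add ((hπK _ _).trans (mul_le_mul_of_nonneg_left hΦr hK)) ?_
        rwa [hπΦ z hz]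
      _ = C := hC_def.symm
  refine ⟨hbil, π, fun a b => (hπK a b).trans ?_, hπΦ, fun x => (hclose x).trans ?_, ?_⟩
  · gcongr
    linarith
  · linarith
  · rintro _ ⟨x, rfl⟩
    calc dist (Φ (π (Φ x))) (Φ x) ≤ L * dist (π (Φ x)) x + A := (hΦ (π (Φ x)) x).2
      _ ≤ L * C + A := add_le_add_left (mul_le_mul_of_nonneg_left (hclose x) hL₀.le) A
      _ ≤ K + C + (L * C + A) := by linarith
end

section
/- Let a > 0 and 0 < r₁ ≤ r₂. Let f : ℝ → ℝ be nonnegative and nondecreasing on [r₁, r₂], and suppose that for almost every r ∈ [r₁, r₂] (with respect to Lebesgue measure), f is differentiable at r and satisfies f(r) ≤ a·r·f'(r). Then f(r₂) ≥ (r₂/r₁)^{1/a} · f(r₁). -/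
open MeasureTheory Set

/-- If `f` is nonnegative and nondecreasing on `[r₁, r₂]` and satisfies the
differential inequality `f(r) ≤ a·r·f'(r)` at almost every point of `[r₁, r₂]`, then
`f(r₂) ≥ (r₂/r₁)^{1/a} · f(r₁)`. -/
theorem growth_from_differential_inequality (a r₁ r₂ : ℝ) (ha : 0 < a)
    (hr₁ : 0 < r₁) (hr : r₁ ≤ r₂) (f : ℝ → ℝ)
    (hnonneg : ∀ r ∈ Set.Icc r₁ r₂, 0 ≤ f r)
    (hmono : MonotoneOn f (Set.Icc r₁ r₂))
    (hae : ∀ᵐ r ∂(volume.restrict (Set.Icc r₁ r₂)),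
      DifferentiableAt ℝ f r ∧ f r ≤ a * r * deriv f r) :
    (r₂ / r₁) ^ (1 / a) * f r₁ ≤ f r₂ := by
  rcases (hnonneg r₁ (left_mem_Icc.2 hr)).eq_or_lt with h0 | h0
  · simpa [← h0] using hnonneg r₂ (right_mem_Icc.2 hr)
  have hr₂ : 0 < r₂ := hr₁.trans_le hr
  have hpos : ∀ r ∈ Icc r₁ r₂, 0 < f r := fun r h =>
    h0.trans_le (hmono (left_mem_Icc.2 hr) h h.1)
  have hlog : MonotoneOn (fun r => Real.log (f r)) (Icc r₁ r₂) := fun x hx y hy hxy =>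
    Real.log_le_log (hpos x hx) (hmono hx hy hxy)
  have hlog' : MonotoneOn (fun r => Real.log (f r)) (uIcc r₁ r₂) := by rwa [uIcc_of_le hr]
  have hderiv : ∀ᵐ r ∂(volume.restrict (Icc r₁ r₂)),
      1 / a * r⁻¹ ≤ deriv (fun r => Real.log (f r)) r := by
    filter_upwards [hae, ae_restrict_mem measurableSet_Icc] with r ⟨hd, hle⟩ hmem
    have hf := hpos r hmem
    have hr0 : 0 < r := hr₁.trans_le hmem.1
    rw [deriv.log hd hf.ne', le_div_iff₀ hf]
    calc 1 / a * r⁻¹ * f r ≤ 1 / a * r⁻¹ * (a * r * deriv f r) := by gcongr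
      _ = deriv f r := by field_simp
  have hint : IntervalIntegrable (fun r : ℝ => 1 / a * r⁻¹) volume r₁ r₂ :=
    (intervalIntegrable_inv_iff.2
      (Or.inr (notMem_uIcc_of_lt hr₁ hr₂))).const_mul _
  have hlower := intervalIntegral.integral_mono_ae_restrict hr hint
    hlog'.intervalIntegrable_deriv hderiv
  rw [intervalIntegral.integral_const_mul, integral_inv_of_pos hr₁ hr₂] at hlower
  have hupper := hlog'.intervalIntegral_deriv_mem_uIcc
  rw [uIcc_of_le (sub_nonneg.2 (hlog (left_mem_Icc.2 hr) (right_mem_Icc.2 hr) hr))] at hupper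
  have hq : 0 < r₂ / r₁ := div_pos hr₂ hr₁
  have hpow : 0 < (r₂ / r₁) ^ (1 / a) := Real.rpow_pos_of_pos hq _
  rw [← Real.log_le_log_iff (mul_pos hpow h0) (hpos r₂ (right_mem_Icc.2 hr)),
    Real.log_mul hpow.ne' h0.ne', Real.log_rpow hq]
  linarith [hupper.2]
end

section
/- Let X be a metric space admitting an L'-Lipschitz combing, and let Φ : ℝⁿ → X be an (L,A)-quasi-isometric embedding. Then there exist constants L'', A'' and C, depending only on L, A, L' and n, and a map Φ' : ℝⁿ → X such that Φ' is L''-Lipschitz, Φ' is an (L'',A'')-quasi-isometric embedding, and d(Φ(x), Φ'(x)) ≤ C for every x ∈ ℝⁿ. That is, in a space with a Lipschitz combing every quasiflat can be represented, up to uniformly bounded error, by a Lipschitz quasi-isometric embedding with controlled constants. -/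
open Metric Set

/-- `X` has an `L`-Lipschitz combing: for each pair `x, y` there is an `L`-bilipschitz path
`σ x y : [0, a x y] → X` from `x` to `y`, extended beyond `a x y` by the constant value `y`,
such that `d(σ x y t, σ x y' t) ≤ L·d(y, y')` for all `t ≥ 0`. -/
def HasLipCombing (X : Type*) [MetricSpace X] (L : ℝ) : Prop :=
  ∃ (a : X → X → ℝ) (σ : X → X → ℝ → X),
    (∀ x y : X, 0 ≤ a x y) ∧
    (∀ x y : X, σ x y 0 = x) ∧
    (∀ x y : X, ∀ t : ℝ, a x y ≤ t → σ x y t = y) ∧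
    (∀ x y : X, ∀ s ∈ Set.Icc (0:ℝ) (a x y), ∀ t ∈ Set.Icc (0:ℝ) (a x y),
      L⁻¹ * |s - t| ≤ dist (σ x y s) (σ x y t)
        ∧ dist (σ x y s) (σ x y t) ≤ L * |s - t|) ∧
    (∀ x y y' : X, ∀ t : ℝ, 0 ≤ t → dist (σ x y t) (σ x y' t) ≤ L * dist y y')

/-- A Lipschitz combing gives paths that are Lipschitz on `[0, ∞)` and reach their end point after
a time linear in the distance of the end points. -/
lemma HasLipCombing.exists_lipschitz_paths {X : Type*} [MetricSpace X] {M : ℝ} (hM : 1 ≤ M)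
    (h : HasLipCombing X M) :
    ∃ σ : X → X → ℝ → X,
      (∀ x y, σ x y 0 = x) ∧
      (∀ x y t, M * dist x y ≤ t → σ x y t = y) ∧
      (∀ x y s t, 0 ≤ s → 0 ≤ t → dist (σ x y s) (σ x y t) ≤ M * |s - t|) ∧
      (∀ x y y' t, 0 ≤ t → dist (σ x y t) (σ x y' t) ≤ M * dist y y') := by
  obtain ⟨a, σ, ha, h0, h1, h2, h3⟩ := h
  have hM0 : 0 < M := by linarith
  refine ⟨σ, h0, fun x y t ht => h1 x y t (le_trans ?_ ht), fun x y s t hs ht => ?_, h3⟩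
  · have := (h2 x y 0 ⟨le_rfl, ha x y⟩ (a x y) ⟨ha x y, le_rfl⟩).1
    rw [h0, h1 x y _ le_rfl, zero_sub, abs_neg, abs_of_nonneg (ha x y)] at this
    rwa [inv_mul_le_iff₀ hM0] at this
  · have key : ∀ t, σ x y t = σ x y (min t (a x y)) := by
      intro t
      rcases le_total t (a x y) with h | h
      · rw [min_eq_left h]
      · rw [min_eq_right h, h1 x y t h, h1 x y _ le_rfl]
    rw [key s, key t]
    refine (h2 x y _ ⟨le_min hs (ha x y), min_le_right _ _⟩ _
      ⟨le_min ht (ha x y), min_le_right _ _⟩).2.trans ?_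
    refine mul_le_mul_of_nonneg_left ?_ hM0.le
    refine (abs_min_sub_min_le_max s (a x y) t (a x y)).trans ?_
    rw [sub_self, abs_zero, max_eq_left (abs_nonneg _)]

/-- A Lipschitz approximation of `Φ` on a set `S` can be modified so as to be defined on the
`r`-neighbourhood of a `6r`-separated set `P` as well, by coning off towards the values of `Φ`
on `P`. -/
lemma exists_lipschitz_approx_union {X Y : Type*} [MetricSpace X] [PseudoMetricSpace Y]
    {L A M r K C : ℝ} (hL : 0 ≤ L) (hA : 0 ≤ A) (hM : 1 ≤ M) (hr : 0 < r) (hK : 0 ≤ K)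
    (hC : 0 ≤ C) (hX : HasLipCombing X M) {Φ : Y → X}
    (hΦ : ∀ x y, dist (Φ x) (Φ y) ≤ L * dist x y + A)
    {P : Set Y} (hP : ∀ p ∈ P, ∀ q ∈ P, dist p q ≤ 6 * r → p = q)
    {S : Set Y} {G : Y → X} (hG : ∀ x ∈ S, ∀ y ∈ S, dist (G x) (G y) ≤ K * dist x y)
    (hGΦ : ∀ x ∈ S, dist (Φ x) (G x) ≤ C)
    {T C' K' : ℝ} (hT : T = M * (3 * L * r + A + C)) (hC' : C' = C + M * T + 2 * L * r + A)
    (hK' : K' = M * K + M * (T / r) + (2 * C' + A) / r + L) :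
    ∃ G' : Y → X,
      (∀ x ∈ S ∪ {x | ∃ p ∈ P, dist x p ≤ r}, ∀ y ∈ S ∪ {x | ∃ p ∈ P, dist x p ≤ r},
        dist (G' x) (G' y) ≤ K' * dist x y) ∧
      ∀ x ∈ S ∪ {x | ∃ p ∈ P, dist x p ≤ r}, dist (Φ x) (G' x) ≤ C' := by
  classical
  obtain ⟨σ, h0, h1, h2, h3⟩ := hX.exists_lipschitz_paths hM
  have hM0 : 0 < M := by linarith
  have hT0 : 0 ≤ T := by rw [hT]; positivity
  have hC'0 : 0 ≤ C' := by rw [hC']; positivity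
  let τ : Y → Y → ℝ := fun p x => T * max 0 (dist x p / r - 1)
  have hτ0 : ∀ p x, 0 ≤ τ p x := fun p x => mul_nonneg hT0 (le_max_left _ _)
  have hτ : ∀ p x y, |τ p x - τ p y| ≤ T / r * dist x y := by
    intro p x y
    have hmax : |max 0 (dist x p / r - 1) - max 0 (dist y p / r - 1)| ≤
        |(dist x p / r - 1) - (dist y p / r - 1)| := by
      simpa using abs_max_sub_max_le_max 0 (dist x p / r - 1) 0 (dist y p / r - 1)
    have hd : |(dist x p / r - 1) - (dist y p / r - 1)| ≤ dist x y / r := by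
      rw [sub_sub_sub_cancel_right, ← sub_div, abs_div, abs_of_pos hr]
      gcongr
      exact abs_dist_sub_le x y p
    calc |τ p x - τ p y| = T * |max 0 (dist x p / r - 1) - max 0 (dist y p / r - 1)| := by
          rw [← mul_sub, abs_mul, abs_of_nonneg hT0]
      _ ≤ T * (dist x y / r) := by gcongr; exact hmax.trans hd
      _ = T / r * dist x y := by ring
  have hτnear : ∀ p x, dist x p ≤ r → τ p x = 0 := by
    intro p x h
    have : dist x p / r ≤ 1 := (div_le_one hr).2 h
    simp only [τ, max_eq_left (by linarith : dist x p / r - 1 ≤ 0), mul_zero]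
  have hτmid : ∀ p x, dist x p ≤ 2 * r → τ p x ≤ T := by
    intro p x h
    have : dist x p / r ≤ 2 := (div_le_iff₀ hr).2 h
    exact mul_le_of_le_one_right hT0 (max_le zero_le_one (by linarith))
  have hτfar : ∀ p x, 2 * r ≤ dist x p → T ≤ τ p x := by
    intro p x h
    have : 2 ≤ dist x p / r := (le_div_iff₀ hr).2 h
    exact le_mul_of_one_le_right hT0 (le_max_of_le_right (by linarith))
  let F : Y → Y → X := fun p x => σ (Φ p) (G x) (τ p x)
  let G' : Y → X := fun x => if h : ∃ p ∈ P, dist x p ≤ 2 * r then F h.choose x else G x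
  have huniq : ∀ x, ∀ p ∈ P, ∀ q ∈ P, dist x p ≤ 3 * r → dist x q ≤ 3 * r → p = q := by
    intro x p hp q hq hxp hxq
    exact hP p hp q hq (by linarith [dist_triangle_left p q x])
  have hG'far : ∀ x, (¬ ∃ p ∈ P, dist x p ≤ 2 * r) → G' x = G x := fun x h => dif_neg h
  have hfarS : ∀ x ∈ S ∪ {x | ∃ p ∈ P, dist x p ≤ r}, (¬ ∃ p ∈ P, dist x p ≤ 2 * r) → x ∈ S := by
    rintro x (hx | ⟨p, hp, hxp⟩) h
    · exact hx
    · exact absurd ⟨p, hp, by linarith⟩ h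
  have hG'F : ∀ x ∈ S ∪ {x | ∃ p ∈ P, dist x p ≤ r}, ∀ p ∈ P, dist x p ≤ 3 * r →
      G' x = F p x := by
    intro x hx p hp hxp
    by_cases h : ∃ p ∈ P, dist x p ≤ 2 * r
    · have hc := h.choose_spec
      have : h.choose = p := huniq x _ hc.1 p hp (by linarith [hc.2]) hxp
      simp only [G', dif_pos h, this]
    · have hxS := hfarS x hx h
      rw [hG'far x h]
      refine (h1 _ _ _ (le_trans ?_ (hτfar p x ?_))).symm
      · rw [hT]
        have := dist_triangle (Φ p) (Φ x) (G x)
        have h4 := hΦ p x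
        have h5 : L * dist p x ≤ L * (3 * r) := by rw [dist_comm p x]; gcongr
        have h6 := hGΦ x hxS
        gcongr
        linarith
      · by_contra! hlt
        exact h ⟨p, hp, hlt.le⟩
  have hclose : ∀ x ∈ S ∪ {x | ∃ p ∈ P, dist x p ≤ r}, dist (Φ x) (G' x) ≤ C' := by
    intro x hx
    have hMT : 0 ≤ M * T := by positivity
    have hLr : 0 ≤ L * r := by positivity
    by_cases h : ∃ p ∈ P, dist x p ≤ 2 * r
    · obtain ⟨p, hp, hxp⟩ := h
      rw [hG'F x hx p hp (by linarith)]
      have h4 := hΦ x p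
      have h5 : L * dist x p ≤ L * (2 * r) := by gcongr
      have h6 : dist (Φ p) (F p x) ≤ M * T := by
        have := h2 (Φ p) (G x) 0 (τ p x) le_rfl (hτ0 p x)
        rw [h0, zero_sub, abs_neg, abs_of_nonneg (hτ0 p x)] at this
        refine this.trans ?_
        gcongr
        exact hτmid p x hxp
      have := dist_triangle (Φ x) (Φ p) (F p x)
      linarith
    · rw [hG'far x h]
      have := hGΦ x (hfarS x hx h)
      linarith
  have hFlip : ∀ x ∈ S ∪ {x | ∃ p ∈ P, dist x p ≤ r}, ∀ y ∈ S ∪ {x | ∃ p ∈ P, dist x p ≤ r},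
      ∀ p ∈ P, dist x p ≤ 3 * r → dist y p ≤ 3 * r →
      dist (F p x) (F p y) ≤ (M * K + M * (T / r)) * dist x y := by
    intro x hx y hy p hp hxp hyp
    have hMτ : M * |τ p x - τ p y| ≤ M * (T / r * dist x y) := by gcongr; exact hτ p x y
    have hMK : 0 ≤ M * K * dist x y := by positivity
    have hzero : ∀ z ∈ S ∪ {x | ∃ p ∈ P, dist x p ≤ r}, dist z p ≤ 3 * r → z ∉ S →
        τ p z = 0 := by
      rintro z (hz | ⟨q, hq, hzq⟩) hzp hzS
      · exact absurd hz hzS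
      · rw [huniq z p hp q hq hzp (by linarith)]
        exact hτnear q z hzq
    by_cases hxS : x ∈ S
    · by_cases hyS : y ∈ S
      · have h4 := h3 (Φ p) (G x) (G y) (τ p x) (hτ0 p x)
        have h5 := h2 (Φ p) (G y) (τ p x) (τ p y) (hτ0 p x) (hτ0 p y)
        have h6 : M * dist (G x) (G y) ≤ M * (K * dist x y) := by
          gcongr
          exact hG x hxS y hyS
        have := dist_triangle (F p x) (σ (Φ p) (G y) (τ p x)) (F p y)
        linarith
      · have hy0 := hzero y hy hyp hyS
        have h5 := h2 (Φ p) (G x) (τ p x) (τ p y) (hτ0 p x) (hτ0 p y)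
        have h6 : F p y = σ (Φ p) (G x) (τ p y) := by simp only [F, hy0, h0]
        rw [h6]
        linarith
    · have hx0 := hzero x hx hxp hxS
      have h5 := h2 (Φ p) (G y) (τ p x) (τ p y) (hτ0 p x) (hτ0 p y)
      have h6 : F p x = σ (Φ p) (G y) (τ p x) := by simp only [F, hx0, h0]
      rw [h6]
      linarith
  refine ⟨G', fun x hx y hy => ?_, hclose⟩
  have hsmall : (M * K + M * (T / r)) * dist x y ≤ K' * dist x y := by
    have : 0 ≤ (2 * C' + A) / r := by positivity
    gcongr
    linarith
  rcases le_or_gt (dist x y) r with hxy | hxy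
  · by_cases hx2 : ∃ p ∈ P, dist x p ≤ 2 * r
    · obtain ⟨p, hp, hxp⟩ := hx2
      have hxp3 : dist x p ≤ 3 * r := by linarith
      have hyp3 : dist y p ≤ 3 * r := by linarith [dist_triangle_left y p x]
      rw [hG'F x hx p hp hxp3, hG'F y hy p hp hyp3]
      exact (hFlip x hx y hy p hp hxp3 hyp3).trans hsmall
    · by_cases hy2 : ∃ p ∈ P, dist y p ≤ 2 * r
      · obtain ⟨p, hp, hyp⟩ := hy2
        have hyp3 : dist y p ≤ 3 * r := by linarith
        have hxp3 : dist x p ≤ 3 * r := by linarith [dist_triangle x y p]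
        rw [hG'F x hx p hp hxp3, hG'F y hy p hp hyp3]
        exact (hFlip x hx y hy p hp hxp3 hyp3).trans hsmall
      · rw [hG'far x hx2, hG'far y hy2]
        refine (hG x (hfarS x hx hx2) y (hfarS y hy hy2)).trans (le_trans ?_ hsmall)
        have : 0 ≤ M * (T / r) := by positivity
        have : K ≤ M * K := le_mul_of_one_le_left hK hM
        gcongr
        linarith
  · have h4 := hclose x hx
    have h5 := hclose y hy
    have h6 := hΦ x y
    have h8 : 2 * C' + A ≤ (2 * C' + A) / r * dist x y := by
      rw [div_mul_eq_mul_div, le_div_iff₀ hr]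
      gcongr
    have h9 : 0 ≤ (M * K + M * (T / r)) * dist x y := by positivity
    have h10 : dist (G' x) (G' y) ≤ dist (Φ x) (G' x) + dist (Φ x) (Φ y) + dist (Φ y) (G' y) := by
      have := dist_triangle4 (G' x) (Φ x) (Φ y) (G' y)
      rwa [dist_comm (G' x) (Φ x)] at this
    rw [hK']
    linarith

/-- On a union of finitely many neighbourhoods of separated sets, coarsely Lipschitz maps into
spaces with a Lipschitz combing are uniformly close to Lipschitz maps. -/
lemma exists_lipschitz_approx_biUnion {Y ι : Type*} [PseudoMetricSpace Y] {L A M r : ℝ}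
    (hL : 0 ≤ L) (hA : 0 ≤ A) (hM : 1 ≤ M) (hr : 0 < r) {P : ι → Set Y}
    (hP : ∀ c, ∀ p ∈ P c, ∀ q ∈ P c, dist p q ≤ 6 * r → p = q) (s : Finset ι) :
    ∃ K C : ℝ, 0 ≤ K ∧ 0 ≤ C ∧ ∀ (X : Type) [MetricSpace X], HasLipCombing X M →
      ∀ Φ : Y → X, (∀ x y, dist (Φ x) (Φ y) ≤ L * dist x y + A) →
        ∃ G : Y → X,
          (∀ x ∈ {x | ∃ c ∈ s, ∃ p ∈ P c, dist x p ≤ r},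
            ∀ y ∈ {x | ∃ c ∈ s, ∃ p ∈ P c, dist x p ≤ r}, dist (G x) (G y) ≤ K * dist x y) ∧
          ∀ x ∈ {x | ∃ c ∈ s, ∃ p ∈ P c, dist x p ≤ r}, dist (Φ x) (G x) ≤ C := by
  classical
  induction s using Finset.induction_on with
  | empty => exact ⟨0, 0, le_rfl, le_rfl, fun X _ _ Φ _ => ⟨Φ, by simp, by simp⟩⟩
  | insert c s _ ih =>
    obtain ⟨K, C, hK, hC, h⟩ := ih
    obtain ⟨T, hT⟩ : ∃ T, T = M * (3 * L * r + A + C) := ⟨_, rfl⟩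
    obtain ⟨C', hC'⟩ : ∃ C', C' = C + M * T + 2 * L * r + A := ⟨_, rfl⟩
    obtain ⟨K', hK'⟩ : ∃ K', K' = M * K + M * (T / r) + (2 * C' + A) / r + L := ⟨_, rfl⟩
    have hT0 : 0 ≤ T := by rw [hT]; positivity
    have hC'0 : 0 ≤ C' := by rw [hC']; positivity
    refine ⟨K', C', by rw [hK']; positivity, hC'0, fun X _ hX Φ hΦ => ?_⟩
    obtain ⟨G, hG, hGΦ⟩ := h X hX Φ hΦ
    have hset : {x | ∃ d ∈ insert c s, ∃ p ∈ P d, dist x p ≤ r} =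
        {x | ∃ d ∈ s, ∃ p ∈ P d, dist x p ≤ r} ∪ {x | ∃ p ∈ P c, dist x p ≤ r} := by
      ext x
      simp only [Finset.mem_insert, exists_eq_or_imp, mem_ofPred_eq, mem_union]
      exact or_comm
    rw [hset]
    exact exists_lipschitz_approx_union hL hA hM hr hK hC hX hΦ (hP c) hG hGΦ hT hC' hK'

/-- The integer points of `ℝⁿ` with prescribed coordinates modulo `k`. -/
def latticeClass (n k : ℕ) (c : Fin n → ZMod k) : Set (EuclideanSpace ℝ (Fin n)) :=
  {v | ∃ q : Fin n → ℤ, (∀ j, (q j : ZMod k) = c j) ∧ ∀ j, v j = q j}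

lemma eq_of_mem_latticeClass {n k : ℕ} {c : Fin n → ZMod k} {v w : EuclideanSpace ℝ (Fin n)}
    (hv : v ∈ latticeClass n k c) (hw : w ∈ latticeClass n k c) (h : dist v w < k) : v = w := by
  obtain ⟨q, hq, hvq⟩ := hv
  obtain ⟨q', hq', hwq⟩ := hw
  ext j
  have hdvd : (k : ℤ) ∣ q j - q' j := by
    rw [← ZMod.intCast_zmod_eq_zero_iff_dvd]
    push_cast
    rw [hq, hq', sub_self]
  have hlt : |q j - q' j| < (k : ℤ) := by
    have h1 : ‖(v - w) j‖ ≤ ‖v - w‖ := PiLp.norm_apply_le (v - w) j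
    rw [← dist_eq_norm, PiLp.sub_apply, hvq, hwq, Real.norm_eq_abs] at h1
    exact_mod_cast h1.trans_lt h
  have := Int.eq_zero_of_abs_lt_dvd hdvd hlt
  rw [hvq, hwq, sub_eq_zero.1 this]

lemma exists_mem_latticeClass_dist_le (n k : ℕ) (x : EuclideanSpace ℝ (Fin n)) :
    ∃ c, ∃ v ∈ latticeClass n k c, dist x v ≤ n + 1 := by
  refine ⟨fun j => (⌊x j⌋ : ZMod k), WithLp.toLp 2 (fun j => (⌊x j⌋ : ℝ)),
    ⟨fun j => ⌊x j⌋, fun _ => rfl, fun _ => rfl⟩, ?_⟩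
  rw [EuclideanSpace.dist_eq]
  refine Real.sqrt_le_iff.2 ⟨by positivity, ?_⟩
  have hsum : ∑ j : Fin n, dist (x j) (⌊x j⌋ : ℝ) ^ 2 ≤ ∑ _j : Fin n, (1 : ℝ) := by
    refine Finset.sum_le_sum fun j _ => pow_le_one₀ dist_nonneg ?_
    rw [Real.dist_eq, Int.self_sub_floor, abs_of_nonneg (Int.fract_nonneg _)]
    exact (Int.fract_lt_one _).le
  refine hsum.trans ?_
  simp only [Finset.sum_const, Finset.card_univ, Fintype.card_fin, nsmul_eq_mul, mul_one]
  nlinarith [Nat.cast_nonneg (α := ℝ) n]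

/-- In a metric space with an `L'`-Lipschitz combing, every
`(L,A)`-quasi-isometric embedding `Φ : ℝⁿ → X` is at uniformly bounded distance from an
`L''`-Lipschitz `(L'',A'')`-quasi-isometric embedding `Φ'`, with `L''`, `A''` and the error
bound `C` depending only on `L`, `A`, `L'` and `n`. -/
theorem lipschitz_representative_of_quasiflat (n : ℕ) (L A L' : ℝ)
    (hL : 1 ≤ L) (hA : 0 ≤ A) (hL' : 1 ≤ L') :
    ∃ L'' A'' C : ℝ, ∀ (X : Type) [MetricSpace X], HasLipCombing X L' →
      ∀ Φ : EuclideanSpace ℝ (Fin n) → X, IsQIEmb L A Φ →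
        ∃ Φ' : EuclideanSpace ℝ (Fin n) → X,
          (∀ x y, dist (Φ' x) (Φ' y) ≤ L'' * dist x y) ∧
          IsQIEmb L'' A'' Φ' ∧
          ∀ x, dist (Φ x) (Φ' x) ≤ C := by
  have hL0 : 0 < L := by linarith
  have hsep : ∀ c : Fin n → ZMod (6 * n + 7), ∀ p ∈ latticeClass n (6 * n + 7) c,
      ∀ q ∈ latticeClass n (6 * n + 7) c, dist p q ≤ 6 * ((n : ℝ) + 1) → p = q := by
    intro c p hp q hq h
    refine eq_of_mem_latticeClass hp hq (h.trans_lt ?_)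
    push_cast
    linarith
  obtain ⟨K, C, -, hC, h⟩ := exists_lipschitz_approx_biUnion hL0.le hA hL'
    (by positivity : (0 : ℝ) < n + 1) hsep Finset.univ
  have hcov : ∀ x, x ∈ {x | ∃ c ∈ (Finset.univ : Finset (Fin n → ZMod (6 * n + 7))),
      ∃ p ∈ latticeClass n (6 * n + 7) c, dist x p ≤ (n : ℝ) + 1} := by
    intro x
    obtain ⟨c, hc⟩ := exists_mem_latticeClass_dist_le n (6 * n + 7) x
    exact ⟨c, Finset.mem_univ c, hc⟩
  refine ⟨max K L, A + 2 * C, C, fun X _ hX Φ hΦ => ?_⟩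
  obtain ⟨G, hG, hGΦ⟩ := h X hX Φ fun x y => (hΦ x y).2
  have hlip : ∀ x y, dist (G x) (G y) ≤ max K L * dist x y := fun x y =>
    (hG x (hcov x) y (hcov y)).trans (by gcongr; exact le_max_left _ _)
  refine ⟨G, hlip, fun x y => ⟨?_, by linarith [hlip x y]⟩, fun x => hGΦ x (hcov x)⟩
  have h1 : (max K L)⁻¹ * dist x y ≤ L⁻¹ * dist x y := by
    gcongr
    exact le_max_right _ _
  have h2 := (hΦ x y).1
  have h3 := dist_triangle4 (Φ x) (G x) (G y) (Φ y)
  have h4 := hGΦ x (hcov x)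
  have h5 := hGΦ y (hcov y)
  rw [dist_comm (Φ y)] at h5
  linarith
end
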